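/- The series ∑_{k=1}^∞ h_k³/k³ converges and equals (135/128)·ζ(6) + (7/16)·ζ(3)². -/

import Mathlib

open Finset Real

noncomputable def H (k : ℕ) : ℝ := ∑ j ∈ Finset.range k, (1 : ℝ) / ((j : ℝ) + 1)
noncomputable def H2 (k : ℕ) : ℝ := ∑ j ∈ Finset.range k, (1 : ℝ) / ((j : ℝ) + 1) ^ 2
noncomputable def H3 (k : ℕ) : ℝ := ∑ j ∈ Finset.range k, (1 : ℝ) / ((j : ℝ) + 1) ^ 3
noncomputable def h (k : ℕ) : ℝ := ∑ j ∈ Finset.range k, (1 : ℝ) / (2 * (j : ℝ) + 1)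
noncomputable def h2 (k : ℕ) : ℝ := ∑ j ∈ Finset.range k, (1 : ℝ) / (2 * (j : ℝ) + 1) ^ 2
noncomputable def h3 (k : ℕ) : ℝ := ∑ j ∈ Finset.range k, (1 : ℝ) / (2 * (j : ℝ) + 1) ^ 3
noncomputable def zeta (s : ℕ) : ℝ := ∑' n : ℕ, (1 : ℝ) / ((n : ℝ) + 1) ^ s

open Filter Topology

/-- The product over odd `p < 2 * k` of `(p - x) / (p + x)`, whose expansion at `x = 0` starts with
`1 - 2 * h k * x`. -/
noncomputable def oddRatio (k : ℕ) (x : ℝ) : ℝ :=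
  ∏ i ∈ range k, ((2 * (i : ℝ) + 1) - x) / ((2 * (i : ℝ) + 1) + x)

theorem oddRatio_zero (x : ℝ) : oddRatio 0 x = 1 := by simp [oddRatio]

theorem oddRatio_succ (k : ℕ) (x : ℝ) :
    oddRatio (k + 1) x = oddRatio k x * ((2 * (k : ℝ) + 1 - x) / (2 * (k : ℝ) + 1 + x)) := by
  rw [oddRatio, prod_range_succ, oddRatio]

theorem abs_oddRatio_le_one (k : ℕ) {x : ℝ} (hx : 0 ≤ x) : |oddRatio k x| ≤ 1 := by
  rw [oddRatio, abs_prod]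
  refine prod_le_one (fun _ _ => abs_nonneg _) fun i _ => ?_
  have hi : (0 : ℝ) ≤ i := i.cast_nonneg
  rw [abs_div, abs_of_pos (by linarith : 0 < 2 * (i : ℝ) + 1 + x)]
  refine div_le_one_of_le₀ ?_ (by linarith)
  rw [abs_le]; constructor <;> linarith

theorem oddRatio_succ_add_two (k : ℕ) {x : ℝ} (hx : 0 ≤ x) :
    oddRatio (k + 1) (x + 2) =
      -(1 + x) ^ 2 * oddRatio k x / ((2 * k + 1 + x) * (2 * k + 3 + x)) := by
  induction k with
  | zero =>
    have h1 : 1 + x ≠ 0 := by positivity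
    have h3 : 3 + x ≠ 0 := by positivity
    simp only [oddRatio_succ, oddRatio_zero, Nat.cast_zero, mul_zero, zero_add]
    rw [show 1 + (x + 2) = 3 + x by ring]
    field_simp
    ring
  | succ k ih =>
    have hk : (0 : ℝ) ≤ k := k.cast_nonneg
    have h1 : 2 * (k : ℝ) + 1 + x ≠ 0 := by positivity
    have h3 : 2 * (k : ℝ) + 3 + x ≠ 0 := by positivity
    have h5 : 2 * (k : ℝ) + 5 + x ≠ 0 := by positivity
    rw [oddRatio_succ, ih, oddRatio_succ]
    push_cast
    rw [show 2 * ((k : ℝ) + 1) + 1 + (x + 2) = 2 * k + 5 + x by ring,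
      show 2 * ((k : ℝ) + 1) + 1 + x = 2 * k + 3 + x by ring,
      show 2 * ((k : ℝ) + 1) + 3 + x = 2 * k + 5 + x by ring,
      show 2 * ((k : ℝ) + 1) + 1 - (x + 2) = 2 * k + 1 - x by ring]
    field_simp

theorem oddRatio_sub_oddRatio_add_two (k : ℕ) {x : ℝ} (hx : 0 ≤ x) :
    oddRatio (k + 1) x - oddRatio (k + 1) (x + 2) =
      -4 / (1 + x) ^ 2 * ((k + 1) ^ 2 * oddRatio (k + 1) (x + 2)) := by
  have h1 : 2 * (k : ℝ) + 1 + x ≠ 0 := by positivity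
  have h3 : 2 * (k : ℝ) + 3 + x ≠ 0 := by positivity
  have h0 : 1 + x ≠ 0 := by positivity
  rw [oddRatio_succ_add_two k hx, oddRatio_succ]
  field_simp
  ring

theorem abs_oddRatio_add_two_le (k : ℕ) {x : ℝ} (hx : 0 ≤ x) :
    |oddRatio (k + 1) (x + 2)| ≤ (1 + x) ^ 2 * (1 / ((k : ℝ) + 1) ^ 2) := by
  rw [oddRatio_succ_add_two k hx, abs_div, abs_mul, abs_neg, abs_of_nonneg (sq_nonneg (1 + x)),
    abs_of_pos (by positivity : 0 < (2 * (k : ℝ) + 1 + x) * (2 * k + 3 + x)), mul_div_assoc]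
  have hk : (0 : ℝ) ≤ k := k.cast_nonneg
  gcongr
  · exact abs_oddRatio_le_one k hx
  · nlinarith [mul_nonneg hk hx, mul_nonneg hx hx, mul_nonneg hk hk]

theorem abs_oddRatio_add_four_le (k : ℕ) {x : ℝ} (hx : 0 ≤ x) :
    |oddRatio (k + 1) (x + 4)| ≤ (3 + x) ^ 2 * (1 + x) ^ 2 * (4 / ((k : ℝ) + 1) ^ 4) := by
  have hk : (0 : ℝ) ≤ k := k.cast_nonneg
  have e : x + 4 = (x + 2) + 2 := by ring
  rw [e, oddRatio_succ_add_two k (by linarith), abs_div, abs_mul, abs_neg,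
    abs_of_nonneg (sq_nonneg (1 + (x + 2))),
    abs_of_pos (by positivity : 0 < (2 * (k : ℝ) + 1 + (x + 2)) * (2 * k + 3 + (x + 2))),
    div_le_iff₀ (by positivity)]
  have h1 : |oddRatio k (x + 2)| ≤ (1 + x) ^ 2 * (4 / ((k : ℝ) + 1) ^ 2) := by
    cases k with
    | zero =>
      refine (abs_oddRatio_le_one 0 (by linarith)).trans ?_
      norm_num
      nlinarith
    | succ k =>
      refine (abs_oddRatio_add_two_le k hx).trans ?_
      gcongr ?_ * ?_
      have : (0 : ℝ) ≤ k := k.cast_nonneg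
      rw [div_le_div_iff₀ (by positivity) (by positivity)]
      push_cast
      nlinarith
  have h2 : ((k : ℝ) + 1) ^ 2 ≤ (2 * (k : ℝ) + 1 + (x + 2)) * (2 * k + 3 + (x + 2)) := by
    nlinarith [mul_nonneg hk hx, mul_nonneg hx hx, mul_nonneg hk hk]
  calc (1 + (x + 2)) ^ 2 * |oddRatio k (x + 2)|
      ≤ (1 + (x + 2)) ^ 2 * ((1 + x) ^ 2 * (4 / ((k : ℝ) + 1) ^ 2)) := by gcongr
    _ = (3 + x) ^ 2 * (1 + x) ^ 2 * (4 / ((k : ℝ) + 1) ^ 4) * ((k : ℝ) + 1) ^ 2 := by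
        field_simp
        ring
    _ ≤ _ := by gcongr

theorem summable_one_div_succ_pow {p : ℕ} (hp : 1 < p) :
    Summable fun k : ℕ => 1 / ((k : ℝ) + 1) ^ p := by
  have := (summable_nat_add_iff 1).2 (Real.summable_one_div_nat_pow.2 hp)
  simpa using this

theorem tendsto_oddRatio_add_nat (k : ℕ) (x : ℝ) :
    Tendsto (fun n : ℕ => oddRatio k (x + 2 * n)) atTop (𝓝 ((-1) ^ k)) := by
  have key (i : ℕ) : Tendsto (fun n : ℕ => ((2 * (i : ℝ) + 1) - (x + 2 * n)) /
      ((2 * (i : ℝ) + 1) + (x + 2 * n))) atTop (𝓝 (-1)) := by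
    have ht : Tendsto (fun n : ℕ => (2 * (i : ℝ) + 1) + (x + 2 * n)) atTop atTop :=
      tendsto_atTop_add_const_left _ _ (tendsto_atTop_add_const_left _ _
        (tendsto_natCast_atTop_atTop.const_mul_atTop two_pos))
    have h2 : Tendsto (fun n : ℕ => 2 * (2 * (i : ℝ) + 1) / ((2 * (i : ℝ) + 1) + (x + 2 * n)) - 1)
        atTop (𝓝 (0 - 1)) := (ht.const_div_atTop _).sub_const 1
    rw [zero_sub] at h2
    refine h2.congr' ?_
    filter_upwards [ht.eventually_gt_atTop 0] with n hn
    rw [eq_div_iff hn.ne', sub_mul, div_mul_cancel₀ _ hn.ne']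
    ring
  simpa [oddRatio] using tendsto_finsetProd (range k) fun i _ => key i

/-- The generating function whose third Taylor coefficient contains the sum of
`h (k + 1) ^ 3 / (k + 1) ^ 3`. -/
noncomputable def cubicRatioSum (x : ℝ) : ℝ := ∑' k : ℕ, oddRatio (k + 1) x / ((k : ℝ) + 1) ^ 3

noncomputable def linearRatioSum (x : ℝ) : ℝ := ∑' k : ℕ, oddRatio (k + 1) x / ((k : ℝ) + 1)

theorem summable_cubicRatio {x : ℝ} (hx : 0 ≤ x) :
    Summable fun k : ℕ => oddRatio (k + 1) x / ((k : ℝ) + 1) ^ 3 := by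
  refine .of_norm_bounded (summable_one_div_succ_pow (p := 3) (by norm_num)) fun k => ?_
  rw [norm_div, norm_of_nonneg (by positivity : 0 ≤ ((k : ℝ) + 1) ^ 3)]
  gcongr
  exact abs_oddRatio_le_one _ hx

theorem summable_linearRatio {x : ℝ} (hx : 0 ≤ x) :
    Summable fun k : ℕ => oddRatio (k + 1) (x + 2) / ((k : ℝ) + 1) := by
  refine .of_norm_bounded ((summable_one_div_succ_pow (p := 2) (by norm_num)).mul_left
    ((1 + x) ^ 2)) fun k => ?_
  rw [norm_div, norm_of_nonneg (by positivity : 0 ≤ (k : ℝ) + 1)]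
  refine (div_le_self (norm_nonneg _) ?_).trans (abs_oddRatio_add_two_le k hx)
  linarith [(k.cast_nonneg : (0 : ℝ) ≤ k)]

theorem cubicRatioSum_sub {x : ℝ} (hx : 0 ≤ x) :
    cubicRatioSum x - cubicRatioSum (x + 2) = -4 / (1 + x) ^ 2 * linearRatioSum (x + 2) := by
  rw [cubicRatioSum, cubicRatioSum, linearRatioSum, ← (summable_cubicRatio hx).tsum_sub
    (summable_cubicRatio (by linarith)), ← tsum_mul_left]
  refine tsum_congr fun k => ?_
  rw [← sub_div, oddRatio_sub_oddRatio_add_two k hx]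
  field_simp

theorem hasSum_of_telescope {f T : ℕ → ℝ} (hf : ∀ k, T (k + 1) - T k = f k) (hs : Summable f)
    (hT : Tendsto T atTop (𝓝 0)) : HasSum f (-T 0) := by
  have h := hs.hasSum.tendsto_sum_nat
  have e : (fun n => ∑ i ∈ range n, f i) = fun n => T n - T 0 := by
    funext n
    rw [← sum_range_sub]
    exact sum_congr rfl fun k _ => (hf k).symm
  rw [e] at h
  have := tendsto_nhds_unique h (hT.sub_const (T 0))
  rw [zero_sub] at this
  exact this ▸ hs.hasSum

theorem hasSum_mul_oddRatio {x : ℝ} (hx : 0 ≤ x) :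
    HasSum (fun k : ℕ => ((k : ℝ) + 1) * oddRatio (k + 1) (x + 4)) (-(x + 3) / (4 * (x + 2))) := by
  have hb (k : ℕ) : |((k : ℝ) + 1) * oddRatio (k + 1) (x + 4)| ≤
      (3 + x) ^ 2 * (1 + x) ^ 2 * 4 * (1 / ((k : ℝ) + 1) ^ 3) := by
    rw [abs_mul, abs_of_nonneg (by positivity : 0 ≤ (k : ℝ) + 1)]
    calc _ ≤ ((k : ℝ) + 1) * ((3 + x) ^ 2 * (1 + x) ^ 2 * (4 / ((k : ℝ) + 1) ^ 4)) := by
          gcongr; exact abs_oddRatio_add_four_le k hx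
      _ = _ := by field_simp
  have hs : Summable fun k : ℕ => ((k : ℝ) + 1) * oddRatio (k + 1) (x + 4) :=
    .of_norm_bounded ((summable_one_div_succ_pow (p := 3) (by norm_num)).mul_left _) hb
  have hT : Tendsto (fun k : ℕ => -(((k : ℝ) + 1 / 2 + (x + 4) / 2) * (k + 1 / 2) *
      oddRatio (k + 1) (x + 4)) / (x + 2)) atTop (𝓝 0) := by
    rw [← zero_div (x + 2)]
    refine Tendsto.div_const ?_ _
    rw [← neg_zero]
    refine Tendsto.neg ?_
    have hz : Tendsto (fun k : ℕ => (3 + x) ^ 2 * (1 + x) ^ 2 * 4 * (3 + x) *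
        (1 / ((k : ℝ) + 1) ^ 2)) atTop (𝓝 0) := by
      simpa using (summable_one_div_succ_pow (p := 2) (by norm_num)).tendsto_atTop_zero.const_mul
        ((3 + x) ^ 2 * (1 + x) ^ 2 * 4 * (3 + x))
    refine squeeze_zero_norm (fun k => ?_) hz
    have hk : (0 : ℝ) ≤ k := k.cast_nonneg
    have h1 : (k : ℝ) + 1 / 2 + (x + 4) / 2 ≤ (3 + x) * (k + 1) := by nlinarith
    rw [norm_mul, norm_of_nonneg (by positivity)]
    calc _ ≤ ((3 + x) * (k + 1)) * (k + 1) *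
          ((3 + x) ^ 2 * (1 + x) ^ 2 * (4 / ((k : ℝ) + 1) ^ 4)) := by
          gcongr
          · linarith
          · exact abs_oddRatio_add_four_le k hx
      _ = _ := by field_simp
  have h := hasSum_of_telescope (T := fun k : ℕ => -(((k : ℝ) + 1 / 2 + (x + 4) / 2) * (k + 1 / 2) *
      oddRatio (k + 1) (x + 4)) / (x + 2)) (fun k => ?_) hs hT
  · convert h using 1
    simp only [oddRatio_succ, oddRatio_zero]
    push_cast
    have : 1 + (x + 4) ≠ 0 := by positivity
    have : x + 2 ≠ 0 := by positivity
    field_simp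
    ring_nf
  · rw [oddRatio_succ (k + 1)]
    push_cast
    have : 2 * ((k : ℝ) + 1) + 1 + (x + 4) ≠ 0 := by positivity
    have : x + 2 ≠ 0 := by positivity
    field_simp
    ring

theorem linearRatioSum_sub {x : ℝ} (hx : 0 ≤ x) :
    linearRatioSum (x + 2) - linearRatioSum (x + 4) = 1 / ((x + 2) * (x + 3)) := by
  have e : x + 4 = (x + 2) + 2 := by ring
  have h2 : Summable fun k : ℕ => oddRatio (k + 1) (x + 4) / ((k : ℝ) + 1) := by
    rw [e]; exact summable_linearRatio (by linarith)
  rw [linearRatioSum, linearRatioSum, ← (summable_linearRatio hx).tsum_sub h2]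
  have h := (hasSum_mul_oddRatio hx).mul_left (-4 / (x + 3) ^ 2)
  have : x + 2 ≠ 0 := by positivity
  have h3 : x + 3 ≠ 0 := by positivity
  rw [show 1 / ((x + 2) * (x + 3)) = -4 / (x + 3) ^ 2 * (-(x + 3) / (4 * (x + 2))) by
    field_simp, ← h.tsum_eq]
  refine tsum_congr fun k => ?_
  rw [← sub_div, e, oddRatio_sub_oddRatio_add_two k (by linarith), show 1 + (x + 2) = x + 3 by ring]
  field_simp

/-- The alternating harmonic series with consecutive terms paired; its sum is `log 2`. -/
noncomputable def pairedLogTwo : ℝ := ∑' m : ℕ, 1 / ((2 * (m : ℝ) + 1) * (2 * m + 2))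

theorem summable_of_le_one_div_succ_sq {f : ℕ → ℝ} (h0 : ∀ k, 0 ≤ f k)
    (h1 : ∀ k, f k ≤ 1 / ((k : ℝ) + 1) ^ 2) : Summable f :=
  .of_nonneg_of_le h0 h1 (summable_one_div_succ_pow (by norm_num))

theorem hasSum_pairedLogTwo :
    HasSum (fun m : ℕ => 1 / ((2 * (m : ℝ) + 1) * (2 * m + 2))) pairedLogTwo := by
  refine (summable_of_le_one_div_succ_sq (fun _ => by positivity) fun m => ?_).hasSum
  gcongr
  nlinarith [(m.cast_nonneg : (0 : ℝ) ≤ m)]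

theorem hasSum_alternating :
    HasSum (fun k : ℕ => (-1 : ℝ) ^ (k + 1) / (((k : ℝ) + 1) * (k + 2))) (1 - 2 * pairedLogTwo) := by
  have hodd : HasSum (fun m : ℕ => 1 / ((2 * (m : ℝ) + 2) * (2 * m + 3))) (1 - pairedLogTwo) := by
    have ht : HasSum (fun m : ℕ => 1 / ((2 * (m : ℝ) + 1) * (2 * m + 2)) +
        1 / ((2 * (m : ℝ) + 2) * (2 * m + 3))) (-(-1 / (2 * ((0 : ℕ) : ℝ) + 1))) := by
      refine hasSum_of_telescope (T := fun m : ℕ => -1 / (2 * (m : ℝ) + 1)) (fun m => ?_) ?_ ?_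
      · push_cast
        have : 2 * ((m : ℝ) + 1) + 1 ≠ 0 := by positivity
        field_simp
        ring
      · refine hasSum_pairedLogTwo.summable.add
          (summable_of_le_one_div_succ_sq (fun _ => by positivity) fun m => ?_)
        gcongr
        nlinarith [(m.cast_nonneg : (0 : ℝ) ≤ m)]
      · exact (tendsto_atTop_add_const_right _ _
          (tendsto_natCast_atTop_atTop.const_mul_atTop two_pos)).const_div_atTop _
    have := ht.sub hasSum_pairedLogTwo
    simpa using this
  have h := HasSum.even_add_odd
    (f := fun k : ℕ => (-1 : ℝ) ^ (k + 1) / (((k : ℝ) + 1) * (k + 2)))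
    (m := -pairedLogTwo) (m' := 1 - pairedLogTwo) ?_ ?_
  · convert h using 1
    ring
  · refine hasSum_pairedLogTwo.neg.congr_fun fun m => ?_
    push_cast
    rw [Odd.neg_one_pow ⟨m, rfl⟩, neg_div]
  · refine hodd.congr_fun fun m => ?_
    push_cast
    rw [Even.neg_one_pow ⟨m + 1, by ring⟩]
    ring

theorem summable_oddRatio_div {x : ℝ} (hx : 0 ≤ x) :
    Summable fun k : ℕ => oddRatio (k + 1) x / (((k : ℝ) + 1) * (k + 2)) := by
  refine .of_norm_bounded (summable_one_div_succ_pow (p := 2) (by norm_num)) fun k => ?_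
  rw [norm_div, Real.norm_of_nonneg (by positivity : 0 ≤ ((k : ℝ) + 1) * (k + 2))]
  gcongr
  · exact abs_oddRatio_le_one _ hx
  · nlinarith [(k.cast_nonneg : (0 : ℝ) ≤ k)]

theorem linearRatioSum_add_two {x : ℝ} (hx : 0 ≤ x) :
    linearRatioSum (x + 2) = -(x + 1) / (2 * (x + 2)) +
      (1 / 2 + 1 / (2 * (x + 2))) *
        ∑' k : ℕ, oddRatio (k + 1) (x + 2) / (((k : ℝ) + 1) * (k + 2)) := by
  have hx2 : x + 2 ≠ 0 := by positivity
  have hd := (summable_oddRatio_div (x := x + 2) (by linarith)).hasSum.mul_left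
    (1 / 2 + 1 / (2 * (x + 2)))
  have hl := (summable_linearRatio hx).hasSum
  have hT : Tendsto (fun k : ℕ => -(((k : ℝ) + 1 / 2 + (x + 2) / 2) * oddRatio (k + 1) (x + 2)) /
      ((x + 2) * (k + 1))) atTop (𝓝 0) := by
    have hz : Tendsto (fun k : ℕ => (1 + x) ^ 2 * (1 / ((k : ℝ) + 1) ^ 2)) atTop (𝓝 0) := by
      simpa using (summable_one_div_succ_pow (p := 2) (by norm_num)).tendsto_atTop_zero.const_mul
        ((1 + x) ^ 2)
    refine squeeze_zero_norm (fun k => ?_) hz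
    have hk : (0 : ℝ) ≤ k := k.cast_nonneg
    rw [norm_div, norm_neg, norm_mul, Real.norm_of_nonneg (by positivity : 0 ≤ (x + 2) * ((k : ℝ) + 1)),
      Real.norm_of_nonneg (by positivity), div_le_iff₀ (by positivity)]
    have h1 : (k : ℝ) + 1 / 2 + (x + 2) / 2 ≤ (x + 2) * (k + 1) := by nlinarith [mul_nonneg hx hk]
    rw [mul_comm ((1 + x) ^ 2 * _)]
    gcongr
    exact abs_oddRatio_add_two_le k hx
  have h := hasSum_of_telescope (f := fun k : ℕ => oddRatio (k + 1) (x + 2) / ((k : ℝ) + 1) -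
      (1 / 2 + 1 / (2 * (x + 2))) * (oddRatio (k + 1) (x + 2) / (((k : ℝ) + 1) * (k + 2))))
    (T := fun k : ℕ => -(((k : ℝ) + 1 / 2 + (x + 2) / 2) * oddRatio (k + 1) (x + 2)) /
      ((x + 2) * (k + 1))) (fun k => ?_) (hl.sub hd).summable hT
  · have := h.unique (hl.sub hd)
    rw [linearRatioSum, ← sub_eq_iff_eq_add, ← this]
    simp only [oddRatio_succ, oddRatio_zero]
    push_cast
    have : 1 + (x + 2) ≠ 0 := by positivity
    field_simp
    ring
  · rw [oddRatio_succ (k + 1)]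
    push_cast
    have : 2 * ((k : ℝ) + 1) + 1 + (x + 2) ≠ 0 := by positivity
    have : (k : ℝ) + 1 + 1 ≠ 0 := by positivity
    have : (k : ℝ) + 2 ≠ 0 := by positivity
    field_simp
    ring

theorem tendsto_linearRatioSum {x : ℝ} (hx : 0 ≤ x) :
    Tendsto (fun n : ℕ => linearRatioSum (x + 2 * n + 2)) atTop (𝓝 (-pairedLogTwo)) := by
  have e (n : ℕ) : linearRatioSum (x + 2 * n + 2) = _ :=
    linearRatioSum_add_two (x := x + 2 * n) (by positivity)
  simp_rw [e]
  have hat : Tendsto (fun n : ℕ => 2 * (x + 2 * n + 2)) atTop atTop := by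
    refine Tendsto.const_mul_atTop two_pos (tendsto_atTop_add_const_right _ _
      (tendsto_atTop_add_const_left _ _ (tendsto_natCast_atTop_atTop.const_mul_atTop two_pos)))
  have h1 : Tendsto (fun n : ℕ => 1 / (2 * (x + 2 * n + 2))) atTop (𝓝 0) := hat.const_div_atTop _
  have h2 : Tendsto (fun n : ℕ => -(x + 2 * n + 1) / (2 * (x + 2 * n + 2))) atTop
      (𝓝 (0 - 1 / 2)) := by
    refine (h1.sub_const (1 / 2)).congr fun n => ?_
    have : x + 2 * n + 2 ≠ 0 := by positivity
    field_simp
    ring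
  have h3 : Tendsto (fun n : ℕ => ∑' k : ℕ, oddRatio (k + 1) (x + 2 * n + 2) /
      (((k : ℝ) + 1) * (k + 2))) atTop (𝓝 (1 - 2 * pairedLogTwo)) := by
    rw [← hasSum_alternating.tsum_eq]
    refine tendsto_tsum_of_dominated_convergence
      (summable_one_div_succ_pow (p := 2) (by norm_num)) (fun k => ?_) (.of_forall fun n k => ?_)
    · refine Tendsto.div_const ?_ _
      refine (tendsto_oddRatio_add_nat (k + 1) (x + 2)).congr fun n => ?_
      congr 1
      ring
    · rw [norm_div, Real.norm_of_nonneg (by positivity : 0 ≤ ((k : ℝ) + 1) * (k + 2))]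
      gcongr
      · exact abs_oddRatio_le_one _ (by positivity)
      · nlinarith [(k.cast_nonneg : (0 : ℝ) ≤ k)]
  have := h2.add ((h1.const_add (1 / 2)).mul h3)
  convert this using 2
  ring

theorem hasSum_linearRatioSum {x : ℝ} (hx : 0 ≤ x) :
    HasSum (fun j : ℕ => 1 / ((x + 2 * j + 2) * (x + 2 * j + 3)))
      (linearRatioSum (x + 2) + pairedLogTwo) := by
  have h := hasSum_of_telescope (f := fun j : ℕ => 1 / ((x + 2 * j + 2) * (x + 2 * j + 3)))
    (T := fun j : ℕ => -(linearRatioSum (x + 2 * j + 2) + pairedLogTwo)) (fun j => ?_) ?_ ?_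
  · simpa using h
  · have := linearRatioSum_sub (x := x + 2 * j) (by positivity)
    rw [← this]
    push_cast
    rw [show x + 2 * ((j : ℝ) + 1) + 2 = x + 2 * j + 4 by ring]
    ring
  · refine summable_of_le_one_div_succ_sq (fun _ => by positivity) fun j => ?_
    gcongr
    nlinarith [(j.cast_nonneg : (0 : ℝ) ≤ j)]
  · have := ((tendsto_linearRatioSum hx).add_const pairedLogTwo).neg
    simpa using this

theorem tendsto_cubicRatioSum {x : ℝ} (hx : 0 ≤ x) :
    Tendsto (fun n : ℕ => cubicRatioSum (x + 2 * n)) atTop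
      (𝓝 (∑' k : ℕ, (-1 : ℝ) ^ (k + 1) / ((k : ℝ) + 1) ^ 3)) := by
  refine tendsto_tsum_of_dominated_convergence
    (summable_one_div_succ_pow (p := 3) (by norm_num)) (fun k => ?_) (.of_forall fun n k => ?_)
  · exact (tendsto_oddRatio_add_nat (k + 1) x).div_const _
  · rw [norm_div, Real.norm_of_nonneg (by positivity : 0 ≤ ((k : ℝ) + 1) ^ 3)]
    gcongr
    exact abs_oddRatio_le_one _ (by positivity)

theorem summable_prod_of_le {f : ℕ × ℕ → ℝ} (C : ℝ) (h0 : ∀ p, 0 ≤ f p)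
    (h1 : ∀ p, f p ≤ C * (1 / ((p.1 : ℝ) + 1) ^ 2 * (1 / ((p.2 : ℝ) + 1) ^ 2))) : Summable f := by
  have h := summable_one_div_succ_pow (p := 2) (by norm_num)
  exact .of_nonneg_of_le h0 h1 ((h.mul_of_nonneg h (fun _ => by positivity)
    (fun _ => by positivity)).mul_left C)

theorem summable_ratioKernel {x : ℝ} (hx : 0 ≤ x) :
    Summable fun p : ℕ × ℕ => 1 / (2 * (p.1 : ℝ) + 1 + x) ^ 2 *
      (1 / ((2 * (p.1 : ℝ) + 2 * p.2 + 2 + x) * (2 * p.1 + 2 * p.2 + 3 + x))) := by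
  refine summable_prod_of_le 1 (fun _ => by positivity) fun p => ?_
  have h1 : (0 : ℝ) ≤ p.1 := p.1.cast_nonneg
  have h2 : (0 : ℝ) ≤ p.2 := p.2.cast_nonneg
  rw [one_mul]
  refine mul_le_mul (one_div_le_one_div_of_le (by positivity) (pow_le_pow_left₀ (by positivity)
    (by linarith) 2)) (one_div_le_one_div_of_le (by positivity) ?_) (by positivity) (by positivity)
  rw [sq]
  refine mul_le_mul ?_ ?_ (by positivity) (by positivity) <;> linarith

theorem cubicRatioSum_eq {x : ℝ} (hx : 0 ≤ x) :
    cubicRatioSum x = ∑' k : ℕ, (-1 : ℝ) ^ (k + 1) / ((k : ℝ) + 1) ^ 3 +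
      4 * pairedLogTwo * ∑' n : ℕ, 1 / (2 * (n : ℝ) + 1 + x) ^ 2 -
      4 * ∑' p : ℕ × ℕ, 1 / (2 * (p.1 : ℝ) + 1 + x) ^ 2 *
        (1 / ((2 * (p.1 : ℝ) + 2 * p.2 + 2 + x) * (2 * p.1 + 2 * p.2 + 3 + x))) := by
  have hs : Summable fun n : ℕ => 1 / (2 * (n : ℝ) + 1 + x) ^ 2 := by
    refine summable_of_le_one_div_succ_sq (fun _ => by positivity) fun n => ?_
    have := (n.cast_nonneg : (0 : ℝ) ≤ n)
    exact one_div_le_one_div_of_le (by positivity) (pow_le_pow_left₀ (by positivity) (by linarith) 2)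
  have hK := summable_ratioKernel hx
  have hin (n : ℕ) : HasSum (fun j : ℕ => 1 / (2 * (n : ℝ) + 1 + x) ^ 2 *
      (1 / ((2 * (n : ℝ) + 2 * j + 2 + x) * (2 * n + 2 * j + 3 + x))))
      (1 / (2 * (n : ℝ) + 1 + x) ^ 2 * (linearRatioSum (x + 2 * n + 2) + pairedLogTwo)) := by
    refine ((hasSum_linearRatioSum (x := x + 2 * n) (by positivity)).mul_left _).congr_fun
      fun j => ?_
    ring
  have hout := (hK.hasSum.prod_fiberwise hin).mul_left 4
  have hT := (tendsto_cubicRatioSum hx).sub_const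
    (∑' k : ℕ, (-1 : ℝ) ^ (k + 1) / ((k : ℝ) + 1) ^ 3)
  rw [sub_self] at hT
  have hL := hs.hasSum.mul_left (4 * pairedLogTwo)
  have h := hasSum_of_telescope (fun n => ?_) (hout.sub hL).summable hT
  · have := h.unique (hout.sub hL)
    simp only [Nat.cast_zero, mul_zero, add_zero] at this
    linarith
  · have := cubicRatioSum_sub (x := x + 2 * n) (by positivity)
    push_cast
    rw [show x + 2 * ((n : ℝ) + 1) = x + 2 * n + 2 by ring]
    have h1 : 1 + (x + 2 * (n : ℝ)) ≠ 0 := by positivity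
    have h2 : cubicRatioSum (x + 2 * n + 2) = cubicRatioSum (x + 2 * n) -
      -4 / (1 + (x + 2 * n)) ^ 2 * linearRatioSum (x + 2 * n + 2) := by linarith
    rw [h2, show 2 * (n : ℝ) + 1 + x = 1 + (x + 2 * n) by ring]
    field_simp
    ring

/-- `f` agrees with the cubic polynomial with coefficients `c₀, …, c₃` up to `M * x ^ 4` on `[0, 1]`,
and the coefficients are bounded by `M`. -/
structure CubicJet (f : ℝ → ℝ) (c₀ c₁ c₂ c₃ M : ℝ) : Prop where
  coeff_zero : |c₀| ≤ M
  coeff_one : |c₁| ≤ M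
  coeff_two : |c₂| ≤ M
  coeff_three : |c₃| ≤ M
  remainder : ∀ x, 0 ≤ x → x ≤ 1 → |f x - (c₀ + c₁ * x + c₂ * x ^ 2 + c₃ * x ^ 3)| ≤ M * x ^ 4

namespace CubicJet

variable {f g : ℝ → ℝ} {c₀ c₁ c₂ c₃ d₀ d₁ d₂ d₃ M N : ℝ}

theorem nonneg (hf : CubicJet f c₀ c₁ c₂ c₃ M) : 0 ≤ M := (abs_nonneg _).trans hf.coeff_zero

theorem abs_poly_le (h₀ : |c₀| ≤ M) (h₁ : |c₁| ≤ M) (h₂ : |c₂| ≤ M) (h₃ : |c₃| ≤ M) {x : ℝ}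
    (hx : 0 ≤ x) (hx1 : x ≤ 1) : |c₀ + c₁ * x + c₂ * x ^ 2 + c₃ * x ^ 3| ≤ 4 * M := by
  have hM : 0 ≤ M := (abs_nonneg _).trans h₀
  have aux (c : ℝ) (hc : |c| ≤ M) (n : ℕ) : |c * x ^ n| ≤ M := by
    rw [abs_mul, abs_of_nonneg (pow_nonneg hx n)]
    exact (mul_le_of_le_one_right (abs_nonneg _) (pow_le_one₀ hx hx1)).trans hc
  have a1 := aux c₁ h₁ 1
  rw [pow_one] at a1
  have := abs_add_le (c₀ + c₁ * x + c₂ * x ^ 2) (c₃ * x ^ 3)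
  have := abs_add_le (c₀ + c₁ * x) (c₂ * x ^ 2)
  have := abs_add_le c₀ (c₁ * x)
  linarith [aux c₂ h₂ 2, aux c₃ h₃ 3]

theorem abs_le (hf : CubicJet f c₀ c₁ c₂ c₃ M) {x : ℝ} (hx : 0 ≤ x) (hx1 : x ≤ 1) :
    |f x| ≤ 5 * M := by
  have h1 := hf.remainder x hx hx1
  have h2 := abs_poly_le hf.coeff_zero hf.coeff_one hf.coeff_two hf.coeff_three hx hx1
  have h3 : M * x ^ 4 ≤ M := mul_le_of_le_one_right hf.nonneg (pow_le_one₀ hx hx1)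
  have := abs_add_le (f x - (c₀ + c₁ * x + c₂ * x ^ 2 + c₃ * x ^ 3))
    (c₀ + c₁ * x + c₂ * x ^ 2 + c₃ * x ^ 3)
  rw [sub_add_cancel] at this
  linarith

theorem const (c : ℝ) : CubicJet (fun _ => c) c 0 0 0 |c| :=
  ⟨le_rfl, by simp, by simp, by simp, fun x hx _ => by simp; positivity⟩

theorem const_mul (a : ℝ) (hf : CubicJet f c₀ c₁ c₂ c₃ M) :
    CubicJet (fun x => a * f x) (a * c₀) (a * c₁) (a * c₂) (a * c₃) (|a| * M) := by
  have aux (c : ℝ) (hc : |c| ≤ M) : |a * c| ≤ |a| * M := by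
    rw [abs_mul]; gcongr
  refine ⟨aux _ hf.1, aux _ hf.2, aux _ hf.3, aux _ hf.4, fun x hx hx1 => ?_⟩
  rw [show a * f x - (a * c₀ + a * c₁ * x + a * c₂ * x ^ 2 + a * c₃ * x ^ 3) =
    a * (f x - (c₀ + c₁ * x + c₂ * x ^ 2 + c₃ * x ^ 3)) by ring, abs_mul, mul_assoc]
  gcongr
  exact hf.remainder x hx hx1

theorem add (hf : CubicJet f c₀ c₁ c₂ c₃ M) (hg : CubicJet g d₀ d₁ d₂ d₃ N) :
    CubicJet (fun x => f x + g x) (c₀ + d₀) (c₁ + d₁) (c₂ + d₂) (c₃ + d₃) (M + N) := by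
  refine ⟨(abs_add_le _ _).trans (add_le_add hf.1 hg.1), (abs_add_le _ _).trans (add_le_add hf.2 hg.2),
    (abs_add_le _ _).trans (add_le_add hf.3 hg.3), (abs_add_le _ _).trans (add_le_add hf.4 hg.4),
    fun x hx hx1 => ?_⟩
  have := abs_add_le (f x - (c₀ + c₁ * x + c₂ * x ^ 2 + c₃ * x ^ 3))
    (g x - (d₀ + d₁ * x + d₂ * x ^ 2 + d₃ * x ^ 3))
  rw [show f x + g x - (c₀ + d₀ + (c₁ + d₁) * x + (c₂ + d₂) * x ^ 2 + (c₃ + d₃) * x ^ 3) =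
    (f x - (c₀ + c₁ * x + c₂ * x ^ 2 + c₃ * x ^ 3)) +
    (g x - (d₀ + d₁ * x + d₂ * x ^ 2 + d₃ * x ^ 3)) by ring, add_mul]
  linarith [hf.remainder x hx hx1, hg.remainder x hx hx1]

theorem mul (hf : CubicJet f c₀ c₁ c₂ c₃ M) (hg : CubicJet g d₀ d₁ d₂ d₃ N) :
    CubicJet (fun x => f x * g x) (c₀ * d₀) (c₀ * d₁ + c₁ * d₀) (c₀ * d₂ + c₁ * d₁ + c₂ * d₀)
      (c₀ * d₃ + c₁ * d₂ + c₂ * d₁ + c₃ * d₀) (15 * (M * N)) := by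
  have hM := hf.nonneg
  have hN := hg.nonneg
  have hMN : 0 ≤ M * N := mul_nonneg hM hN
  have aux {c d : ℝ} (hc : |c| ≤ M) (hd : |d| ≤ N) : |c * d| ≤ M * N := by
    rw [abs_mul]; gcongr
  obtain ⟨f0, f1, f2, f3, fr⟩ := id hf
  obtain ⟨g0, g1, g2, g3, gr⟩ := id hg
  refine ⟨?_, ?_, ?_, ?_, fun x hx hx1 => ?_⟩
  · linarith [aux f0 g0]
  · linarith [abs_add_le (c₀ * d₁) (c₁ * d₀), aux f0 g1, aux f1 g0]
  · linarith [abs_add_le (c₀ * d₂ + c₁ * d₁) (c₂ * d₀), abs_add_le (c₀ * d₂) (c₁ * d₁),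
      aux f0 g2, aux f1 g1, aux f2 g0]
  · linarith [abs_add_le (c₀ * d₃ + c₁ * d₂ + c₂ * d₁) (c₃ * d₀),
      abs_add_le (c₀ * d₃ + c₁ * d₂) (c₂ * d₁), abs_add_le (c₀ * d₃) (c₁ * d₂),
      aux f0 g3, aux f1 g2, aux f2 g1, aux f3 g0]
  · set p := c₀ + c₁ * x + c₂ * x ^ 2 + c₃ * x ^ 3 with hp
    set q := d₀ + d₁ * x + d₂ * x ^ 2 + d₃ * x ^ 3 with hq
    have hpb : |p| ≤ 4 * M := abs_poly_le f0 f1 f2 f3 hx hx1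
    have hgb : |g x| ≤ 5 * N := hg.abs_le hx hx1
    have e : f x * g x - (c₀ * d₀ + (c₀ * d₁ + c₁ * d₀) * x +
        (c₀ * d₂ + c₁ * d₁ + c₂ * d₀) * x ^ 2 +
        (c₀ * d₃ + c₁ * d₂ + c₂ * d₁ + c₃ * d₀) * x ^ 3) =
        (f x - p) * g x + p * (g x - q) + ((c₁ * d₃ + c₂ * d₂ + c₃ * d₁) +
          (c₂ * d₃ + c₃ * d₂) * x + c₃ * d₃ * x ^ 2) * x ^ 4 := by
      rw [hp, hq]; ring
    rw [e]
    have b1 : |(f x - p) * g x| ≤ (M * x ^ 4) * (5 * N) := by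
      rw [abs_mul]
      exact mul_le_mul (fr x hx hx1) hgb (abs_nonneg _) (by positivity)
    have b2 : |p * (g x - q)| ≤ (4 * M) * (N * x ^ 4) := by
      rw [abs_mul]
      exact mul_le_mul hpb (gr x hx hx1) (abs_nonneg _) (by positivity)
    have b3 : |((c₁ * d₃ + c₂ * d₂ + c₃ * d₁) + (c₂ * d₃ + c₃ * d₂) * x + c₃ * d₃ * x ^ 2) * x ^ 4|
        ≤ 6 * (M * N) * x ^ 4 := by
      rw [abs_mul, abs_of_nonneg (by positivity : 0 ≤ x ^ 4)]
      gcongr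
      have t1 := abs_add_le (c₁ * d₃ + c₂ * d₂ + c₃ * d₁ + (c₂ * d₃ + c₃ * d₂) * x) (c₃ * d₃ * x ^ 2)
      have t2 := abs_add_le (c₁ * d₃ + c₂ * d₂ + c₃ * d₁) ((c₂ * d₃ + c₃ * d₂) * x)
      have t3 := abs_add_le (c₁ * d₃ + c₂ * d₂) (c₃ * d₁)
      have t4 := abs_add_le (c₁ * d₃) (c₂ * d₂)
      have t5 := abs_add_le (c₂ * d₃) (c₃ * d₂)
      have t6 : |(c₂ * d₃ + c₃ * d₂) * x| ≤ |c₂ * d₃ + c₃ * d₂| := by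
        rw [abs_mul, abs_of_nonneg hx]
        exact mul_le_of_le_one_right (abs_nonneg _) hx1
      have t7 : |c₃ * d₃ * x ^ 2| ≤ |c₃ * d₃| := by
        rw [abs_mul, abs_of_nonneg (sq_nonneg x)]
        exact mul_le_of_le_one_right (abs_nonneg _) (pow_le_one₀ hx hx1)
      linarith [aux f1 g3, aux f2 g2, aux f3 g1, aux f2 g3, aux f3 g2, aux f3 g3]
    have t1 := abs_add_le ((f x - p) * g x + p * (g x - q)) (((c₁ * d₃ + c₂ * d₂ + c₃ * d₁) +
      (c₂ * d₃ + c₃ * d₂) * x + c₃ * d₃ * x ^ 2) * x ^ 4)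
    have t2 := abs_add_le ((f x - p) * g x) (p * (g x - q))
    linarith

theorem one_div_add {a : ℝ} (ha : 1 ≤ a) :
    CubicJet (fun x => 1 / (a + x)) (1 / a) (-1 / a ^ 2) (1 / a ^ 3) (-1 / a ^ 4) (1 / a) := by
  have h0 : 0 < a := by linarith
  have aux (n : ℕ) : 1 / a ^ (n + 1) ≤ 1 / a :=
    one_div_le_one_div_of_le h0 (le_self_pow₀ ha (by omega))
  refine ⟨?_, ?_, ?_, ?_, fun x hx hx1 => ?_⟩
  · rw [abs_of_nonneg (by positivity)]
  · rw [neg_div, abs_neg, abs_of_nonneg (by positivity)]; exact aux 1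
  · rw [abs_of_nonneg (by positivity)]; exact aux 2
  · rw [neg_div, abs_neg, abs_of_nonneg (by positivity)]; exact aux 3
  · have : a + x ≠ 0 := by positivity
    rw [show 1 / (a + x) - (1 / a + -1 / a ^ 2 * x + 1 / a ^ 3 * x ^ 2 + -1 / a ^ 4 * x ^ 3) =
      1 / (a ^ 4 * (a + x)) * x ^ 4 by field_simp; ring, abs_of_nonneg (by positivity)]
    gcongr
    have : 1 ≤ a ^ 4 := one_le_pow₀ ha
    nlinarith

theorem tsum {ι : Type*} {F : ι → ℝ → ℝ} {c₀ c₁ c₂ c₃ M : ι → ℝ}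
    (hF : ∀ i, CubicJet (F i) (c₀ i) (c₁ i) (c₂ i) (c₃ i) (M i)) (hM : Summable M) :
    CubicJet (fun x => ∑' i, F i x) (∑' i, c₀ i) (∑' i, c₁ i) (∑' i, c₂ i) (∑' i, c₃ i)
      (∑' i, M i) := by
  have s₀ : Summable c₀ := .of_norm_bounded hM fun i => (hF i).1
  have s₁ : Summable c₁ := .of_norm_bounded hM fun i => (hF i).2
  have s₂ : Summable c₂ := .of_norm_bounded hM fun i => (hF i).3
  have s₃ : Summable c₃ := .of_norm_bounded hM fun i => (hF i).4
  have aux {c : ι → ℝ} (hc : ∀ i, |c i| ≤ M i) : |∑' i, c i| ≤ ∑' i, M i :=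
    tsum_of_norm_bounded (f := c) hM.hasSum hc
  refine ⟨aux fun i => (hF i).1, aux fun i => (hF i).2, aux fun i => (hF i).3,
    aux fun i => (hF i).4, fun x hx hx1 => ?_⟩
  have sF : Summable fun i => F i x := .of_norm_bounded (hM.mul_left 5) fun i => (hF i).abs_le hx hx1
  have hs := sF.hasSum.sub (((s₀.hasSum.add (s₁.hasSum.mul_right x)).add
    (s₂.hasSum.mul_right (x ^ 2))).add (s₃.hasSum.mul_right (x ^ 3)))
  rw [← hs.tsum_eq]
  exact tsum_of_norm_bounded
    (f := fun i => F i x - (c₀ i + c₁ i * x + c₂ i * x ^ 2 + c₃ i * x ^ 3))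
    (hM.hasSum.mul_right (x ^ 4)) fun i => (hF i).remainder x hx hx1

theorem coeff_three_unique (hf : CubicJet f c₀ c₁ c₂ c₃ M) (hg : CubicJet g d₀ d₁ d₂ d₃ N)
    (hfg : ∀ x, 0 ≤ x → f x = g x) : c₃ = d₃ := by
  by_contra hne
  have hM := hf.nonneg
  have hN := hg.nonneg
  set δ := |c₃ - d₃| with hδ
  have hδ0 : 0 < δ := abs_pos.2 (sub_ne_zero.2 hne)
  set P : ℝ → ℝ := fun x => (c₀ - d₀) + (c₁ - d₁) * x + (c₂ - d₂) * x ^ 2 + (c₃ - d₃) * x ^ 3 with hP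
  have hb (x : ℝ) (hx : 0 ≤ x) (hx1 : x ≤ 1) : |P x| ≤ (M + N) * x ^ 4 := by
    have h1 := hf.remainder x hx hx1
    have h2 := hg.remainder x hx hx1
    rw [hfg x hx] at h1
    have := abs_sub (g x - (d₀ + d₁ * x + d₂ * x ^ 2 + d₃ * x ^ 3))
      (g x - (c₀ + c₁ * x + c₂ * x ^ 2 + c₃ * x ^ 3))
    rw [show (g x - (d₀ + d₁ * x + d₂ * x ^ 2 + d₃ * x ^ 3)) -
      (g x - (c₀ + c₁ * x + c₂ * x ^ 2 + c₃ * x ^ 3)) = P x by rw [hP]; ring] at this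
    linarith
  set t := δ / (4 * (δ + 100 * (M + N))) with ht
  have hden : 0 < δ + 100 * (M + N) := by positivity
  have ht0 : 0 < t := by positivity
  have ht4 : t ≤ 1 / 4 := by
    rw [ht, div_le_div_iff₀ (by positivity) (by positivity)]
    linarith
  have e : 6 * (c₃ - d₃) * t ^ 3 = P (4 * t) - 3 * P (3 * t) + 3 * P (2 * t) - P t := by
    rw [hP]; ring
  have h1 := abs_le'.1 (hb t ht0.le (by linarith))
  have h2 := abs_le'.1 (hb (2 * t) (by linarith) (by linarith))
  have h3 := abs_le'.1 (hb (3 * t) (by linarith) (by linarith))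
  have h4 := abs_le'.1 (hb (4 * t) (by linarith) (by linarith))
  have h5 : |6 * (c₃ - d₃) * t ^ 3| ≤ 548 * (M + N) * t ^ 4 := by
    rw [e, abs_le']
    constructor <;> nlinarith
  rw [abs_mul, abs_mul, ← hδ, abs_of_pos (by positivity : 0 < t ^ 3), abs_of_pos (by norm_num : (0 : ℝ) < 6)] at h5
  have h6 : 6 * δ ≤ 548 * (M + N) * t := by
    have : (6 * δ) * t ^ 3 ≤ (548 * (M + N) * t) * t ^ 3 := by linarith
    exact le_of_mul_le_mul_right this (by positivity)
  have h7 : t * (4 * (δ + 100 * (M + N))) = δ := by rw [ht]; field_simp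
  nlinarith [mul_pos ht0 hδ0, mul_nonneg ht0.le (add_nonneg hM hN)]

end CubicJet

theorem h_succ (k : ℕ) : h (k + 1) = h k + 1 / (2 * (k : ℝ) + 1) := sum_range_succ _ _

theorem h3_succ (k : ℕ) : h3 (k + 1) = h3 k + 1 / (2 * (k : ℝ) + 1) ^ 3 := sum_range_succ _ _

theorem one_le_h_succ (k : ℕ) : 1 ≤ h (k + 1) := by
  induction k with
  | zero => simp [h]
  | succ k ih =>
    rw [h_succ]
    have : 0 ≤ 1 / (2 * ((k + 1 : ℕ) : ℝ) + 1) := by positivity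
    linarith

theorem h3_nonneg (k : ℕ) : 0 ≤ h3 k := sum_nonneg fun _ _ => by positivity

theorem h3_succ_le (k : ℕ) : h3 (k + 1) ≤ h (k + 1) ^ 3 := by
  induction k with
  | zero => simp [h, h3]
  | succ k ih =>
    rw [h_succ (k + 1), h3_succ (k + 1), ← one_div_pow]
    have hu : 0 ≤ h (k + 1) := by linarith [one_le_h_succ k]
    have hq : 0 ≤ 1 / (2 * ((k + 1 : ℕ) : ℝ) + 1) := by positivity
    nlinarith [mul_nonneg (mul_nonneg hu hq) (add_nonneg hu hq)]

theorem h_pow_four_le (k : ℕ) : h (k + 1) ^ 4 ≤ 625 * ((k : ℝ) + 1) := by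
  have hH : h (k + 1) ≤ harmonic (k + 1) := by
    rw [h, harmonic]
    push_cast
    refine sum_le_sum fun i _ => ?_
    rw [one_div]
    gcongr
    linarith [(i.cast_nonneg : (0 : ℝ) ≤ i)]
  have hk : (0 : ℝ) ≤ (k : ℝ) + 1 := by positivity
  have h1 := harmonic_le_one_add_log (k + 1)
  have h2 := Real.log_le_rpow_div hk (by norm_num : (0 : ℝ) < 1 / 4)
  set y := ((k : ℝ) + 1) ^ (1 / 4 : ℝ) with hy
  have hy1 : 1 ≤ y := Real.one_le_rpow (by linarith [(k.cast_nonneg : (0 : ℝ) ≤ k)]) (by norm_num)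
  have hy4 : y ^ 4 = (k : ℝ) + 1 := by
    rw [hy, ← Real.rpow_natCast, ← Real.rpow_mul hk]
    norm_num
  push_cast at h1
  have h5 : h (k + 1) ≤ 5 * y := by linarith
  calc h (k + 1) ^ 4 ≤ (5 * y) ^ 4 := by
        gcongr
        linarith [one_le_h_succ k]
    _ = 625 * ((k : ℝ) + 1) := by rw [mul_pow, hy4]; norm_num

theorem abs_mul_sub_cubic_le {R u l x b : ℝ} (hx : 0 ≤ x) (hx1 : x ≤ 1) (hb : 1 ≤ b) (hu : 1 ≤ u)
    (hl0 : 0 ≤ l) (hl : l ≤ u ^ 3)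
    (hR : |R - (1 + -2 * u * x + 2 * u ^ 2 * x ^ 2 + -(4 / 3 * u ^ 3 + 2 / 3 * l) * x ^ 3)| ≤
      10 * u ^ 4 * x ^ 4) :
    |R * ((b - x) / (b + x)) - (1 + -2 * (u + 1 / b) * x + 2 * (u + 1 / b) ^ 2 * x ^ 2 +
      -(4 / 3 * (u + 1 / b) ^ 3 + 2 / 3 * (l + 1 / b ^ 3)) * x ^ 3)| ≤
      10 * (u + 1 / b) ^ 4 * x ^ 4 := by
  have hb0 : 0 < b := by linarith
  have hu0 : 0 ≤ u := by linarith
  have hbx : 0 < b + x := by linarith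
  rw [← one_div_pow]
  set q := 1 / b with hq
  have hq0 : 0 < q := by positivity
  have hq1 : q ≤ 1 := by rw [hq, div_le_one hb0]; exact hb
  set c := 4 / 3 * u ^ 3 + 2 / 3 * l with hc
  set P := 1 + -2 * u * x + 2 * u ^ 2 * x ^ 2 + -c * x ^ 3 with hP
  set φ := (b - x) / (b + x) with hφ
  have hφ1 : |φ| ≤ 1 := by
    rw [hφ, abs_div, abs_of_pos hbx]
    refine div_le_one_of_le₀ ?_ hbx.le
    rw [abs_le]; constructor <;> linarith
  set ρ := q ^ 3 / (b + x) with hρ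
  have hφe : φ = 1 - 2 * q * x + 2 * q ^ 2 * x ^ 2 - 2 * q ^ 3 * x ^ 3 + 2 * ρ * x ^ 4 := by
    rw [hφ, hρ, hq]; field_simp; ring
  have hρ0 : 0 ≤ ρ := by positivity
  have hρ1 : ρ ≤ q := by
    rw [hρ]
    exact (div_le_self (by positivity) (by linarith)).trans
      (pow_le_of_le_one hq0.le hq1 (by norm_num))
  have hc0 : 0 ≤ c := by positivity
  have hc1 : c ≤ 2 * u ^ 3 := by rw [hc]; linarith
  have hu1 : u ≤ u ^ 3 := le_self_pow₀ hu (by norm_num)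
  have hu2 : u ^ 2 ≤ u ^ 3 := pow_le_pow_right₀ hu (by norm_num)
  have hu3 : 1 ≤ u ^ 3 := one_le_pow₀ hu
  have hq2 : q ^ 2 ≤ q := pow_le_of_le_one hq0.le hq1 (by norm_num)
  have hq3 : q ^ 3 ≤ q := pow_le_of_le_one hq0.le hq1 (by norm_num)
  have hP1 : |P| ≤ 4 * (2 * u ^ 3) := by
    refine CubicJet.abs_poly_le ?_ ?_ ?_ ?_ hx hx1
    · rw [abs_one]; linarith
    · rw [abs_mul, abs_of_nonneg hu0]; norm_num; exact hu1
    · rw [abs_of_nonneg (by positivity)]; linarith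
    · rw [abs_neg, abs_of_nonneg hc0]; exact hc1
  have key : φ * P - (1 + -2 * (u + q) * x + 2 * (u + q) ^ 2 * x ^ 2 +
      -(4 / 3 * (u + q) ^ 3 + 2 / 3 * (l + q ^ 3)) * x ^ 3) =
      ((2 * (q * c) + 4 * (q ^ 2 * u ^ 2) + 4 * (q ^ 3 * u) + 2 * (q ^ 3 * c) * x ^ 2) -
        (2 * (q ^ 2 * c) + 4 * (q ^ 3 * u ^ 2)) * x + 2 * (ρ * P)) * x ^ 4 := by
    rw [hφe, hP, hc]; ring
  have aux {s t : ℝ} (hs : s ≤ q) (ht0 : 0 ≤ t) (ht : t ≤ u ^ 3) : s * t ≤ q * u ^ 3 :=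
    mul_le_mul hs ht ht0 hq0.le
  have auxc {s : ℝ} (hs : s ≤ q) : s * c ≤ q * (2 * u ^ 3) := mul_le_mul hs hc1 hc0 hq0.le
  have hx2 : 2 * (q ^ 3 * c) * x ^ 2 ≤ 2 * (q ^ 3 * c) :=
    mul_le_of_le_one_right (by positivity) (pow_le_one₀ hx hx1)
  have hx3 : (2 * (q ^ 2 * c) + 4 * (q ^ 3 * u ^ 2)) * x ≤ 2 * (q ^ 2 * c) + 4 * (q ^ 3 * u ^ 2) :=
    mul_le_of_le_one_right (by positivity) hx1
  have hx4 : 0 ≤ (2 * (q ^ 2 * c) + 4 * (q ^ 3 * u ^ 2)) * x := by positivity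
  have hx5 : 0 ≤ 2 * (q * c) + 4 * (q ^ 2 * u ^ 2) + 4 * (q ^ 3 * u) + 2 * (q ^ 3 * c) * x ^ 2 := by
    positivity
  have hρP : |ρ * P| ≤ q * (4 * (2 * u ^ 3)) := by
    rw [abs_mul, abs_of_nonneg hρ0]
    exact mul_le_mul hρ1 hP1 (abs_nonneg _) hq0.le
  have hρP' := _root_.abs_le.1 hρP
  have hF : |(2 * (q * c) + 4 * (q ^ 2 * u ^ 2) + 4 * (q ^ 3 * u) + 2 * (q ^ 3 * c) * x ^ 2) -
        (2 * (q ^ 2 * c) + 4 * (q ^ 3 * u ^ 2)) * x + 2 * (ρ * P)| ≤ 40 * (q * u ^ 3) := by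
    have a1 := auxc le_rfl
    have a2 := auxc hq2
    have a3 := auxc hq3
    have a4 := aux hq2 (by positivity) hu2
    have a5 := aux hq3 hu0 hu1
    have a6 := aux hq3 (by positivity) hu2
    rw [_root_.abs_le]
    constructor <;> linarith
  have hsplit := abs_add_le (φ * (R - P)) (φ * P - (1 + -2 * (u + q) * x +
    2 * (u + q) ^ 2 * x ^ 2 + -(4 / 3 * (u + q) ^ 3 + 2 / 3 * (l + q ^ 3)) * x ^ 3))
  rw [show R * φ - (1 + -2 * (u + q) * x + 2 * (u + q) ^ 2 * x ^ 2 +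
      -(4 / 3 * (u + q) ^ 3 + 2 / 3 * (l + q ^ 3)) * x ^ 3) = φ * (R - P) + (φ * P -
      (1 + -2 * (u + q) * x + 2 * (u + q) ^ 2 * x ^ 2 +
      -(4 / 3 * (u + q) ^ 3 + 2 / 3 * (l + q ^ 3)) * x ^ 3)) by ring]
  have h1 : |φ * (R - P)| ≤ 10 * u ^ 4 * x ^ 4 := by
    rw [abs_mul]
    exact (mul_le_of_le_one_left (abs_nonneg _) hφ1).trans hR
  have h2 : |φ * P - (1 + -2 * (u + q) * x + 2 * (u + q) ^ 2 * x ^ 2 +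
      -(4 / 3 * (u + q) ^ 3 + 2 / 3 * (l + q ^ 3)) * x ^ 3)| ≤ 40 * (q * u ^ 3) * x ^ 4 := by
    rw [key, abs_mul, abs_of_nonneg (by positivity : 0 ≤ x ^ 4)]
    gcongr
  have h3 : u ^ 4 + 4 * (q * u ^ 3) ≤ (u + q) ^ 4 := by
    have : 0 ≤ 6 * u ^ 2 * q ^ 2 + 4 * u * q ^ 3 + q ^ 4 := by positivity
    linarith [show (u + q) ^ 4 = u ^ 4 + 4 * (q * u ^ 3) +
      (6 * u ^ 2 * q ^ 2 + 4 * u * q ^ 3 + q ^ 4) by ring]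
  calc _ ≤ 10 * u ^ 4 * x ^ 4 + 40 * (q * u ^ 3) * x ^ 4 := by linarith
    _ = 10 * (u ^ 4 + 4 * (q * u ^ 3)) * x ^ 4 := by ring
    _ ≤ _ := by gcongr

theorem cubicJet_oddRatio (k : ℕ) :
    CubicJet (oddRatio (k + 1)) 1 (-2 * h (k + 1)) (2 * h (k + 1) ^ 2)
      (-(4 / 3 * h (k + 1) ^ 3 + 2 / 3 * h3 (k + 1))) (10 * h (k + 1) ^ 4) := by
  have hh := one_le_h_succ k
  have hp (m : ℕ) (hm : m ≤ 4) : h (k + 1) ^ m ≤ h (k + 1) ^ 4 := pow_le_pow_right₀ hh hm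
  have h0 : 0 ≤ h (k + 1) := by linarith
  have hp0 := hp 0 (by norm_num)
  have hp1 := hp 1 (by norm_num)
  have hp2 := hp 2 (by norm_num)
  have hp3 := hp 3 (by norm_num)
  rw [pow_zero] at hp0
  rw [pow_one] at hp1
  refine ⟨?_, ?_, ?_, ?_, fun x hx hx1 => ?_⟩
  · rw [abs_one]; linarith
  · rw [abs_mul, abs_of_nonneg h0]; norm_num; linarith
  · rw [abs_of_nonneg (by positivity)]; linarith
  · have := h3_nonneg (k + 1)
    rw [abs_neg, abs_of_nonneg (by positivity)]
    linarith [h3_succ_le k]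
  · clear hp hp0 hp1 hp2 hp3
    induction k with
    | zero =>
      have : (1 : ℝ) + x ≠ 0 := by positivity
      simp only [oddRatio_succ, oddRatio_zero, h, h3]
      norm_num
      rw [show (1 - x) / (1 + x) - (1 + -(2 * x) + 2 * x ^ 2 + -(2 * x ^ 3)) =
        2 * x ^ 4 / (1 + x) by field_simp; ring, abs_of_nonneg (by positivity)]
      exact (div_le_self (by positivity) (by linarith)).trans (by nlinarith [pow_nonneg hx 4])
    | succ k ih =>
      have hu := one_le_h_succ k
      have hl0 := h3_nonneg (k + 1)
      have hl := h3_succ_le k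
      rw [oddRatio_succ (k + 1), h_succ (k + 1), h3_succ (k + 1)]
      refine abs_mul_sub_cubic_le hx hx1 ?_ hu (h3_nonneg _) (h3_succ_le k) (ih hu (by linarith))
      linarith [((k + 1).cast_nonneg : (0 : ℝ) ≤ (k + 1 : ℕ))]

/-- The sum of `1 / (q ^ a * p ^ b)` over odd `p < q` with `q` even. -/
noncomputable def evenOverOdd (a b : ℕ) : ℝ :=
  ∑' x : ℕ × ℕ, 1 / ((2 * ((x.1 : ℝ) + x.2) + 2) ^ a * (2 * x.1 + 1) ^ b)

/-- The sum of `1 / (q ^ a * p ^ b)` over odd `p < q` with `q` odd. -/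
noncomputable def oddOverOdd (a b : ℕ) : ℝ :=
  ∑' x : ℕ × ℕ, 1 / ((2 * ((x.1 : ℝ) + x.2) + 3) ^ a * (2 * x.1 + 1) ^ b)

/-- The sum of `1 / (q ^ a * p ^ b)` over positive even `p < q` with `q` odd. -/
noncomputable def oddOverEven (a b : ℕ) : ℝ :=
  ∑' x : ℕ × ℕ, 1 / ((2 * ((x.1 : ℝ) + x.2) + 3) ^ a * (2 * x.1 + 2) ^ b)

/-- The sum of `1 / p ^ s` over odd `p`. -/
noncomputable def oddZeta (s : ℕ) : ℝ := ∑' n : ℕ, 1 / (2 * (n : ℝ) + 1) ^ s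

/-- The sum of `1 / p ^ s` over positive even `p`. -/
noncomputable def evenZeta (s : ℕ) : ℝ := ∑' n : ℕ, 1 / (2 * (n : ℝ) + 2) ^ s

theorem summable_one_div_mul_pow {s p : ℕ × ℕ → ℝ} (hs₁ : ∀ x, (x.1 : ℝ) + 1 ≤ s x)
    (hs₂ : ∀ x, (x.2 : ℝ) + 1 ≤ s x) (hp : ∀ x, (x.1 : ℝ) + 1 ≤ p x) {a b : ℕ} (ha : 2 ≤ a)
    (hab : 4 ≤ a + b) : Summable fun x => 1 / (s x ^ a * p x ^ b) := by
  have h1 (x : ℕ × ℕ) : (0 : ℝ) < x.1 + 1 := by positivity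
  have h2 (x : ℕ × ℕ) : (0 : ℝ) < x.2 + 1 := by positivity
  have hs0 (x) : 0 < s x := (h1 x).trans_le (hs₁ x)
  have hp0 (x) : 0 < p x := (h1 x).trans_le (hp x)
  refine summable_prod_of_le 1 (fun x => ?_) fun x => ?_
  · have := hs0 x
    have := hp0 x
    positivity
  · have := h1 x
    have := h2 x
    rw [one_mul, one_div_mul_one_div]
    refine one_div_le_one_div_of_le (by positivity) ?_
    obtain ⟨c, rfl⟩ := Nat.exists_eq_add_of_le ha
    calc ((x.1 : ℝ) + 1) ^ 2 * ((x.2 : ℝ) + 1) ^ 2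
        ≤ ((x.1 : ℝ) + 1) ^ (c + b) * ((x.2 : ℝ) + 1) ^ 2 := by
          gcongr
          · linarith [(x.1.cast_nonneg : (0 : ℝ) ≤ x.1)]
          · omega
      _ = ((x.2 : ℝ) + 1) ^ 2 * ((x.1 : ℝ) + 1) ^ c * ((x.1 : ℝ) + 1) ^ b := by ring
      _ ≤ s x ^ 2 * s x ^ c * p x ^ b := by
          have := (hs0 x).le
          gcongr
          exacts [hs₂ x, hs₁ x, hp x]
      _ = _ := by ring

theorem hasSum_evenOverOdd {a b : ℕ} (ha : 2 ≤ a) (hab : 4 ≤ a + b) :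
    HasSum (fun x : ℕ × ℕ => 1 / ((2 * ((x.1 : ℝ) + x.2) + 2) ^ a * (2 * x.1 + 1) ^ b))
      (evenOverOdd a b) := by
  refine (summable_one_div_mul_pow (fun x => ?_) (fun x => ?_) (fun x => ?_) ha hab).hasSum <;>
    linarith [(x.1.cast_nonneg : (0 : ℝ) ≤ x.1), (x.2.cast_nonneg : (0 : ℝ) ≤ x.2)]

theorem hasSum_oddOverOdd {a b : ℕ} (ha : 2 ≤ a) (hab : 4 ≤ a + b) :
    HasSum (fun x : ℕ × ℕ => 1 / ((2 * ((x.1 : ℝ) + x.2) + 3) ^ a * (2 * x.1 + 1) ^ b))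
      (oddOverOdd a b) := by
  refine (summable_one_div_mul_pow (fun x => ?_) (fun x => ?_) (fun x => ?_) ha hab).hasSum <;>
    linarith [(x.1.cast_nonneg : (0 : ℝ) ≤ x.1), (x.2.cast_nonneg : (0 : ℝ) ≤ x.2)]

theorem hasSum_oddOverEven {a b : ℕ} (ha : 2 ≤ a) (hab : 4 ≤ a + b) :
    HasSum (fun x : ℕ × ℕ => 1 / ((2 * ((x.1 : ℝ) + x.2) + 3) ^ a * (2 * x.1 + 2) ^ b))
      (oddOverEven a b) := by
  refine (summable_one_div_mul_pow (fun x => ?_) (fun x => ?_) (fun x => ?_) ha hab).hasSum <;>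
    linarith [(x.1.cast_nonneg : (0 : ℝ) ≤ x.1), (x.2.cast_nonneg : (0 : ℝ) ≤ x.2)]

theorem summable_one_div_pow_of_succ_le {f : ℕ → ℝ} (hf : ∀ n : ℕ, (n : ℝ) + 1 ≤ f n) {s : ℕ}
    (hs : 2 ≤ s) :
    Summable fun n : ℕ => 1 / f n ^ s := by
  have h1 (n : ℕ) : (0 : ℝ) < n + 1 := by positivity
  refine .of_nonneg_of_le (fun n => ?_) (fun n => ?_) (summable_one_div_succ_pow hs)
  · have := (h1 n).trans_le (hf n)
    positivity
  · have := h1 n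
    gcongr
    exact hf n

theorem hasSum_oddZeta {s : ℕ} (hs : 2 ≤ s) :
    HasSum (fun n : ℕ => 1 / (2 * (n : ℝ) + 1) ^ s) (oddZeta s) :=
  (summable_one_div_pow_of_succ_le (fun n => by linarith [(n.cast_nonneg : (0 : ℝ) ≤ n)]) hs).hasSum

theorem hasSum_evenZeta {s : ℕ} (hs : 2 ≤ s) :
    HasSum (fun n : ℕ => 1 / (2 * (n : ℝ) + 2) ^ s) (evenZeta s) :=
  (summable_one_div_pow_of_succ_le (fun n => by linarith [(n.cast_nonneg : (0 : ℝ) ≤ n)]) hs).hasSum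

theorem HasSum.antidiagonal {F : ℕ × ℕ → ℝ} {s : ℝ} (hF : HasSum F s) :
    HasSum (fun k : ℕ => ∑ n ∈ range (k + 1), F (n, k - n)) s := by
  have h := ((HasAntidiagonal.sigmaAntidiagonalEquivProd (A := ℕ)).hasSum_iff.2 hF).sigma
    fun k => hasSum_fintype _
  refine h.congr_fun fun k => ?_
  rw [← Nat.sum_antidiagonal_eq_sum_range_succ_mk, ← sum_coe_sort]
  rfl

theorem hasSum_h3_div :
    HasSum (fun k : ℕ => h3 (k + 1) / ((k : ℝ) + 1) ^ 3) (8 * evenOverOdd 3 3) := by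
  refine ((hasSum_evenOverOdd (a := 3) (b := 3) (by norm_num) (by norm_num)).antidiagonal.mul_left
    8).congr_fun fun k => ?_
  rw [h3, sum_div, mul_sum]
  refine sum_congr rfl fun n hn => ?_
  have : n ≤ k := by simpa [Nat.lt_succ_iff] using hn
  push_cast [this]
  rw [show 2 * ((n : ℝ) + (k - n)) + 2 = 2 * (k + 1) by ring]
  field_simp
  norm_num

theorem summable_h_pow_four : Summable fun k : ℕ => h (k + 1) ^ 4 / ((k : ℝ) + 1) ^ 3 := by
  refine .of_nonneg_of_le (fun k => ?_) (fun k => ?_)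
    ((summable_one_div_succ_pow (p := 2) (by norm_num)).mul_left 625)
  · have := one_le_h_succ k
    positivity
  · rw [div_le_iff₀ (by positivity)]
    refine (h_pow_four_le k).trans_eq ?_
    field_simp

theorem summable_h_pow_three : Summable fun k : ℕ => h (k + 1) ^ 3 / ((k : ℝ) + 1) ^ 3 := by
  have h0 (k : ℕ) := one_le_h_succ k
  refine .of_nonneg_of_le (fun k => ?_) (fun k => ?_) summable_h_pow_four
  · have := h0 k
    positivity
  · gcongr ?_ / _
    exact pow_le_pow_right₀ (h0 k) (by norm_num)

/-- The sum of `1 / (p ^ 5 * (q * (q + 1)))` over odd `p < q` with `q` even. -/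
noncomputable def tailKernelSum : ℝ := ∑' x : ℕ × ℕ, 1 / (2 * (x.1 : ℝ) + 1) ^ 5 *
  (1 / ((2 * ((x.1 : ℝ) + x.2) + 2) * (2 * ((x.1 : ℝ) + x.2) + 3)))

theorem hasSum_tailKernel :
    HasSum (fun x : ℕ × ℕ => 1 / (2 * (x.1 : ℝ) + 1) ^ 5 *
      (1 / ((2 * ((x.1 : ℝ) + x.2) + 2) * (2 * ((x.1 : ℝ) + x.2) + 3)))) tailKernelSum := by
  refine (summable_prod_of_le 1 (fun _ => by positivity) fun x => ?_).hasSum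
  have h1 : (0 : ℝ) ≤ x.1 := x.1.cast_nonneg
  have h2 : (0 : ℝ) ≤ x.2 := x.2.cast_nonneg
  rw [one_mul]
  refine mul_le_mul (one_div_le_one_div_of_le (by positivity) ?_)
    (one_div_le_one_div_of_le (by positivity) ?_) (by positivity) (by positivity)
  · calc ((x.1 : ℝ) + 1) ^ 2 ≤ ((x.1 : ℝ) + 1) ^ 5 :=
        pow_le_pow_right₀ (by linarith) (by norm_num)
      _ ≤ _ := by gcongr; linarith
  · rw [sq]
    refine mul_le_mul ?_ ?_ (by positivity) (by positivity) <;> linarith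

theorem CubicJet.congr {f g : ℝ → ℝ} {c₀ c₁ c₂ c₃ c₃' M : ℝ} (hf : CubicJet f c₀ c₁ c₂ c₃ M)
    (hg : g = f) (hc : c₃' = c₃) : CubicJet g c₀ c₁ c₂ c₃' M := by
  rwa [hg, hc]

theorem cubicJet_cubicRatioSum_left :
    ∃ c₀ c₁ c₂ M, CubicJet cubicRatioSum c₀ c₁ c₂
      (-(4 / 3 * (∑' k : ℕ, h (k + 1) ^ 3 / ((k : ℝ) + 1) ^ 3) + 2 / 3 * (8 * evenOverOdd 3 3)))
      M := by
  have h1 := CubicJet.tsum (fun k : ℕ => (cubicJet_oddRatio k).const_mul (1 / ((k : ℝ) + 1) ^ 3))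
    ((summable_h_pow_four.mul_left 10).congr fun k => by
      rw [abs_of_nonneg (by positivity)]
      ring)
  refine ⟨_, _, _, _, h1.congr ?_ ?_⟩
  · funext x
    exact tsum_congr fun k => by ring
  · have := ((summable_h_pow_three.hasSum.mul_left (4 / 3)).add
      (hasSum_h3_div.mul_left (2 / 3))).neg
    rw [← this.tsum_eq]
    exact tsum_congr fun k => by ring

theorem cubicJet_cubicRatioSum_right :
    ∃ c₀ c₁ c₂ M, CubicJet (fun x => ∑' k : ℕ, (-1 : ℝ) ^ (k + 1) / ((k : ℝ) + 1) ^ 3 +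
        4 * pairedLogTwo * ∑' n : ℕ, 1 / (2 * (n : ℝ) + 1 + x) ^ 2 -
        4 * ∑' p : ℕ × ℕ, 1 / (2 * (p.1 : ℝ) + 1 + x) ^ 2 *
          (1 / ((2 * (p.1 : ℝ) + 2 * p.2 + 2 + x) * (2 * p.1 + 2 * p.2 + 3 + x)))) c₀ c₁ c₂
      (4 * pairedLogTwo * (-4 * oddZeta 5) - 4 * -(4 * tailKernelSum +
        3 * (evenOverOdd 2 4 - oddOverOdd 2 4) + 2 * (evenOverOdd 3 3 - oddOverOdd 3 3) +
        (evenOverOdd 4 2 - oddOverOdd 4 2))) M := by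
  have hp (n : ℕ) : (1 : ℝ) ≤ 2 * n + 1 := by linarith [(n.cast_nonneg : (0 : ℝ) ≤ n)]
  have jp (n : ℕ) := (CubicJet.one_div_add (hp n)).mul (CubicJet.one_div_add (hp n))
  have je (x : ℕ × ℕ) := CubicJet.one_div_add (a := 2 * ((x.1 : ℝ) + x.2) + 2)
    (by linarith [(x.1.cast_nonneg : (0 : ℝ) ≤ x.1), (x.2.cast_nonneg : (0 : ℝ) ≤ x.2)])
  have jo (x : ℕ × ℕ) := CubicJet.one_div_add (a := 2 * ((x.1 : ℝ) + x.2) + 3)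
    (by linarith [(x.1.cast_nonneg : (0 : ℝ) ≤ x.1), (x.2.cast_nonneg : (0 : ℝ) ≤ x.2)])
  have jn := CubicJet.tsum jp (((hasSum_oddZeta le_rfl).summable.mul_left 15).congr fun n => by
    rw [one_div_mul_one_div, ← sq])
  have jx := CubicJet.tsum (fun x : ℕ × ℕ => (jp x.1).mul ((je x).mul (jo x)))
    (((summable_ratioKernel le_rfl).mul_left (15 * 15 * 15)).congr fun x => by
      have h1 : 2 * (x.1 : ℝ) + 2 * x.2 + 2 ≠ 0 := by positivity
      have h2 : 2 * (x.1 : ℝ) + 2 * x.2 + 3 ≠ 0 := by positivity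
      simp only [add_zero]
      rw [mul_add]
      field_simp)
  have jall := ((CubicJet.const (∑' k : ℕ, (-1 : ℝ) ^ (k + 1) / ((k : ℝ) + 1) ^ 3)).add
    (jn.const_mul (4 * pairedLogTwo))).add (jx.const_mul (-4))
  refine ⟨_, _, _, _, jall.congr ?_ ?_⟩
  · funext x
    rw [sub_eq_add_neg, ← neg_mul]
    congr 2
    · congr 1
      exact tsum_congr fun n => by rw [sq, one_div_mul_one_div]
    · congr 1
      funext n
      simp only [sq, one_div_mul_one_div, mul_add]
  · rw [zero_add, sub_eq_add_neg, ← neg_mul]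
    congr 2
    · rw [← ((hasSum_oddZeta (s := 5) (by norm_num)).mul_left (-4)).tsum_eq]
      refine tsum_congr fun n => ?_
      field_simp
      norm_num
    · have e24 := hasSum_evenOverOdd (a := 2) (b := 4) (by norm_num) (by norm_num)
      have e33 := hasSum_evenOverOdd (a := 3) (b := 3) (by norm_num) (by norm_num)
      have e42 := hasSum_evenOverOdd (a := 4) (b := 2) (by norm_num) (by norm_num)
      have o24 := hasSum_oddOverOdd (a := 2) (b := 4) (by norm_num) (by norm_num)
      have o33 := hasSum_oddOverOdd (a := 3) (b := 3) (by norm_num) (by norm_num)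
      have o42 := hasSum_oddOverOdd (a := 4) (b := 2) (by norm_num) (by norm_num)
      have := ((((hasSum_tailKernel.mul_left 4).add ((e24.sub o24).mul_left 3)).add
        ((e33.sub o33).mul_left 2)).add (e42.sub o42)).neg
      rw [← this.tsum_eq]
      refine tsum_congr fun x => ?_
      have h1 : 2 * ((x.1 : ℝ) + x.2) + 2 ≠ 0 := by positivity
      have h2 : 2 * ((x.1 : ℝ) + x.2) + 3 ≠ 0 := by positivity
      have h3 : 2 * (x.1 : ℝ) + 1 ≠ 0 := by positivity
      generalize 2 * ((x.1 : ℝ) + x.2) = s at *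
      generalize 2 * (x.1 : ℝ) + 1 = p at *
      field_simp
      ring

theorem tsum_h_cube_eq :
    ∑' k : ℕ, h (k + 1) ^ 3 / ((k : ℝ) + 1) ^ 3 =
      12 * pairedLogTwo * oddZeta 5 - 12 * tailKernelSum - 4 * evenOverOdd 3 3 -
      9 * (evenOverOdd 2 4 - oddOverOdd 2 4) - 6 * (evenOverOdd 3 3 - oddOverOdd 3 3) -
      3 * (evenOverOdd 4 2 - oddOverOdd 4 2) := by
  obtain ⟨_, _, _, _, h1⟩ := cubicJet_cubicRatioSum_left
  obtain ⟨_, _, _, _, h2⟩ := cubicJet_cubicRatioSum_right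
  have := h1.coeff_three_unique h2 fun x hx => cubicRatioSum_eq hx
  linarith

theorem HasSum.of_split {α β γ : Type*} {G : α → ℝ} {u : β → α} {v : γ → α} {a b : ℝ}
    (hu : u.Injective) (hv : v.Injective) (hd : ∀ x y, u x ≠ v y)
    (hc : ∀ z, (∃ x, u x = z) ∨ ∃ y, v y = z) (ha : HasSum (fun x => G (u x)) a)
    (hb : HasSum (fun y => G (v y)) b) : HasSum G (a + b) := by
  have hs : IsCompl (Set.range u) (Set.range v) := by
    refine ⟨Set.disjoint_left.2 ?_, codisjoint_iff.2 (Set.eq_univ_of_forall hc)⟩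
    rintro _ ⟨x, rfl⟩ ⟨y, hy⟩
    exact hd x y hy.symm
  exact HasSum.add_isCompl hs (hu.hasSum_range_iff.2 ha) (hv.hasSum_range_iff.2 hb)

theorem HasSum.of_triangles {G : ℕ × ℕ → ℝ} {a b : ℝ}
    (ha : HasSum (fun x : ℕ × ℕ => G (x.1, x.1 + x.2)) a)
    (hb : HasSum (fun x : ℕ × ℕ => G (x.1 + 1 + x.2, x.1)) b) : HasSum G (a + b) := by
  refine HasSum.of_split (u := fun x : ℕ × ℕ => (x.1, x.1 + x.2))
    (v := fun x : ℕ × ℕ => (x.1 + 1 + x.2, x.1)) ?_ ?_ ?_ ?_ ha hb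
  · rintro ⟨i, j⟩ ⟨k, l⟩ h
    simp only [Prod.mk.injEq] at h ⊢
    lia
  · rintro ⟨i, j⟩ ⟨k, l⟩ h
    simp only [Prod.mk.injEq] at h ⊢
    lia
  · rintro ⟨i, j⟩ ⟨k, l⟩ h
    simp only [Prod.mk.injEq] at h
    lia
  · rintro ⟨i, j⟩
    rcases le_or_gt i j with h | h
    · exact .inl ⟨(i, j - i), by simp only [Prod.mk.injEq]; lia⟩
    · exact .inr ⟨(j, i - 1 - j), by simp only [Prod.mk.injEq]; lia⟩

theorem HasSum.of_column_zero_succ {G : ℕ × ℕ → ℝ} {a b : ℝ} (ha : HasSum (fun n => G (n, 0)) a)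
    (hb : HasSum (fun x : ℕ × ℕ => G (x.1, x.2 + 1)) b) : HasSum G (a + b) := by
  refine HasSum.of_split (u := fun n : ℕ => (n, 0))
    (v := fun x : ℕ × ℕ => (x.1, x.2 + 1)) ?_ ?_ ?_ ?_ ha hb
  · intro i k h
    simpa using h
  · rintro ⟨i, j⟩ ⟨k, l⟩ h
    simpa using h
  · rintro i ⟨k, l⟩ h
    simp at h
  · rintro ⟨i, _ | j⟩
    · exact .inl ⟨i, rfl⟩
    · exact .inr ⟨(i, j), rfl⟩

theorem HasSum.of_column_even_odd {G : ℕ × ℕ → ℝ} {a b : ℝ}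
    (ha : HasSum (fun x : ℕ × ℕ => G (x.1, 2 * x.2)) a)
    (hb : HasSum (fun x : ℕ × ℕ => G (x.1, 2 * x.2 + 1)) b) : HasSum G (a + b) := by
  refine HasSum.of_split (u := fun x : ℕ × ℕ => (x.1, 2 * x.2))
    (v := fun x : ℕ × ℕ => (x.1, 2 * x.2 + 1)) ?_ ?_ ?_ ?_ ha hb
  · rintro ⟨i, j⟩ ⟨k, l⟩ h
    simp only [Prod.mk.injEq] at h ⊢
    lia
  · rintro ⟨i, j⟩ ⟨k, l⟩ h
    simp only [Prod.mk.injEq] at h ⊢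
    lia
  · rintro ⟨i, j⟩ ⟨k, l⟩ h
    simp only [Prod.mk.injEq] at h
    lia
  · rintro ⟨i, j⟩
    rcases j.even_or_odd' with ⟨l, rfl | rfl⟩
    · exact .inl ⟨(i, l), rfl⟩
    · exact .inr ⟨(i, l), rfl⟩

theorem HasSum.swap {G : ℕ × ℕ → ℝ} {a : ℝ} (hG : HasSum G a) :
    HasSum (fun x : ℕ × ℕ => G (x.2, x.1)) a :=
  (Equiv.prodComm ℕ ℕ).hasSum_iff.2 hG

theorem HasSum.mul_prod {f g : ℕ → ℝ} {a b : ℝ} (hf : HasSum f a) (hg : HasSum g b)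
    (hf0 : ∀ n, 0 ≤ f n) (hg0 : ∀ n, 0 ≤ g n) :
    HasSum (fun x : ℕ × ℕ => f x.1 * g x.2) (a * b) :=
  hf.mul hg (hf.summable.mul_of_nonneg hg.summable hf0 hg0)

theorem hasSum_oddZeta_mul_oddZeta {a b : ℕ} (ha : 2 ≤ a) (hb : 2 ≤ b) :
    HasSum (fun x : ℕ × ℕ => 1 / (2 * (x.1 : ℝ) + 1) ^ a * (1 / (2 * (x.2 : ℝ) + 1) ^ b))
      (oddZeta a * oddZeta b) :=
  (hasSum_oddZeta ha).mul_prod (hasSum_oddZeta hb) (fun _ => by positivity) fun _ => by positivity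

theorem hasSum_oddZeta_mul_evenZeta {a b : ℕ} (ha : 2 ≤ a) (hb : 2 ≤ b) :
    HasSum (fun x : ℕ × ℕ => 1 / (2 * (x.1 : ℝ) + 1) ^ a * (1 / (2 * (x.2 : ℝ) + 2) ^ b))
      (oddZeta a * evenZeta b) :=
  (hasSum_oddZeta ha).mul_prod (hasSum_evenZeta hb) (fun _ => by positivity) fun _ => by positivity

theorem oddZeta_mul_oddZeta {a b : ℕ} (ha : 2 ≤ a) (hb : 2 ≤ b) :
    oddZeta a * oddZeta b = oddZeta (a + b) + oddOverOdd b a + oddOverOdd a b := by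
  refine (hasSum_oddZeta_mul_oddZeta ha hb).unique (.of_triangles (.of_column_zero_succ
    ((hasSum_oddZeta (s := a + b) (by lia)).congr_fun fun n => ?_)
    ((hasSum_oddOverOdd (a := b) (b := a) hb (by lia)).congr_fun fun x => ?_))
    ((hasSum_oddOverOdd (a := a) (b := b) ha (by lia)).congr_fun fun x => ?_))
  · rw [add_zero, one_div_mul_one_div, pow_add]
  · rw [one_div_mul_one_div, mul_comm]
    push_cast
    ring_nf
  · rw [one_div_mul_one_div]
    push_cast
    ring_nf

theorem oddZeta_mul_evenZeta {a b : ℕ} (ha : 2 ≤ a) (hb : 2 ≤ b) :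
    oddZeta a * evenZeta b = evenOverOdd b a + oddOverEven a b := by
  refine (hasSum_oddZeta_mul_evenZeta ha hb).unique (.of_triangles
    ((hasSum_evenOverOdd (a := b) (b := a) hb (by lia)).congr_fun fun x => ?_)
    ((hasSum_oddOverEven (a := a) (b := b) ha (by lia)).congr_fun fun x => ?_))
  · rw [one_div_mul_one_div, mul_comm]
    push_cast
    ring_nf
  · rw [one_div_mul_one_div]
    push_cast
    ring_nf

theorem one_div_cube_mul_cube {a b s : ℝ} (ha : 0 < a) (hb : 0 < b) (hs : a + b = s) :
    1 / a ^ 3 * (1 / b ^ 3) = 1 / (s ^ 3 * a ^ 3) + 1 / (s ^ 3 * b ^ 3) +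
      3 * (1 / (s ^ 4 * a ^ 2) + 1 / (s ^ 4 * b ^ 2)) +
      6 * (1 / (s ^ 5 * a ^ 1) + 1 / (s ^ 5 * b ^ 1)) := by
  subst hs
  field_simp
  ring

theorem one_div_sq_mul_pow_four {a b s : ℝ} (ha : 0 < a) (hb : 0 < b) (hs : a + b = s) :
    1 / a ^ 2 * (1 / b ^ 4) = 4 * (1 / (s ^ 5 * a ^ 1)) + 1 / (s ^ 4 * a ^ 2) +
      (1 / (s ^ 2 * b ^ 4) + 2 * (1 / (s ^ 3 * b ^ 3)) +
        3 * (1 / (s ^ 4 * b ^ 2)) + 4 * (1 / (s ^ 5 * b ^ 1))) := by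
  subst hs
  field_simp
  ring

theorem one_div_pow_five_mul_sub {a b s : ℝ} (ha : 0 < a) (hb : 0 < b) (hs : a + b = s) :
    1 / b ^ 5 * (1 / a - 1 / s) = 1 / (s ^ 5 * a ^ 1) + 1 / (s ^ 5 * b ^ 1) +
      1 / (s ^ 4 * b ^ 2) + 1 / (s ^ 3 * b ^ 3) + 1 / (s ^ 2 * b ^ 4) := by
  subst hs
  field_simp
  ring

theorem oddZeta_three_mul_evenZeta_three :
    oddZeta 3 * evenZeta 3 = oddOverOdd 3 3 + oddOverEven 3 3 +
      3 * (oddOverOdd 4 2 + oddOverEven 4 2) + 6 * (oddOverOdd 5 1 + oddOverEven 5 1) := by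
  have o33 := hasSum_oddOverOdd (a := 3) (b := 3) (by norm_num) (by norm_num)
  have o42 := hasSum_oddOverOdd (a := 4) (b := 2) (by norm_num) (by norm_num)
  have o51 := hasSum_oddOverOdd (a := 5) (b := 1) (by norm_num) (by norm_num)
  have d33 := (hasSum_oddOverEven (a := 3) (b := 3) (by norm_num) (by norm_num)).swap
  have d42 := (hasSum_oddOverEven (a := 4) (b := 2) (by norm_num) (by norm_num)).swap
  have d51 := (hasSum_oddOverEven (a := 5) (b := 1) (by norm_num) (by norm_num)).swap
  refine (hasSum_oddZeta_mul_evenZeta (by norm_num) (by norm_num)).unique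
    ((((o33.add d33).add ((o42.add d42).mul_left 3)).add
      ((o51.add d51).mul_left 6)).congr_fun fun x => ?_)
  rw [add_comm (x.2 : ℝ)]
  exact one_div_cube_mul_cube (by positivity) (by positivity) (by ring)

theorem oddZeta_three_mul_oddZeta_three :
    oddZeta 3 * oddZeta 3 = 2 * evenOverOdd 3 3 + 6 * evenOverOdd 4 2 + 12 * evenOverOdd 5 1 := by
  have e33 := hasSum_evenOverOdd (a := 3) (b := 3) (by norm_num) (by norm_num)
  have e42 := hasSum_evenOverOdd (a := 4) (b := 2) (by norm_num) (by norm_num)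
  have e51 := hasSum_evenOverOdd (a := 5) (b := 1) (by norm_num) (by norm_num)
  have := (hasSum_oddZeta_mul_oddZeta (a := 3) (b := 3) (by norm_num) (by norm_num)).unique
    ((((e33.add e33.swap).add ((e42.add e42.swap).mul_left 3)).add
      ((e51.add e51.swap).mul_left 6)).congr_fun fun x => by
        rw [add_comm (x.2 : ℝ)]
        exact one_div_cube_mul_cube (by positivity) (by positivity) (by ring))
  linarith

theorem oddZeta_two_mul_oddZeta_four :
    oddZeta 2 * oddZeta 4 = 8 * evenOverOdd 5 1 + 4 * evenOverOdd 4 2 + 2 * evenOverOdd 3 3 +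
      evenOverOdd 2 4 := by
  have e24 := hasSum_evenOverOdd (a := 2) (b := 4) (by norm_num) (by norm_num)
  have e33 := hasSum_evenOverOdd (a := 3) (b := 3) (by norm_num) (by norm_num)
  have e42 := hasSum_evenOverOdd (a := 4) (b := 2) (by norm_num) (by norm_num)
  have e51 := hasSum_evenOverOdd (a := 5) (b := 1) (by norm_num) (by norm_num)
  have := (hasSum_oddZeta_mul_oddZeta (a := 2) (b := 4) (by norm_num) (by norm_num)).unique
    ((((e51.mul_left 4).add e42).add (((e24.swap.add (e33.swap.mul_left 2)).add
      (e42.swap.mul_left 3)).add (e51.swap.mul_left 4))).congr_fun fun x => by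
        rw [add_comm (x.2 : ℝ)]
        exact one_div_sq_mul_pow_four (by positivity) (by positivity) (by ring))
  linarith

theorem oddZeta_two_mul_evenZeta_four :
    oddZeta 2 * evenZeta 4 = 4 * oddOverOdd 5 1 + oddOverOdd 4 2 + (oddOverEven 2 4 +
      2 * oddOverEven 3 3 + 3 * oddOverEven 4 2 + 4 * oddOverEven 5 1) := by
  have o42 := hasSum_oddOverOdd (a := 4) (b := 2) (by norm_num) (by norm_num)
  have o51 := hasSum_oddOverOdd (a := 5) (b := 1) (by norm_num) (by norm_num)
  have d24 := (hasSum_oddOverEven (a := 2) (b := 4) (by norm_num) (by norm_num)).swap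
  have d33 := (hasSum_oddOverEven (a := 3) (b := 3) (by norm_num) (by norm_num)).swap
  have d42 := (hasSum_oddOverEven (a := 4) (b := 2) (by norm_num) (by norm_num)).swap
  have d51 := (hasSum_oddOverEven (a := 5) (b := 1) (by norm_num) (by norm_num)).swap
  refine (hasSum_oddZeta_mul_evenZeta (by norm_num) (by norm_num)).unique
    ((((o51.mul_left 4).add o42).add (((d24.add (d33.mul_left 2)).add
      (d42.mul_left 3)).add (d51.mul_left 4))).congr_fun fun x => ?_)
  rw [add_comm (x.2 : ℝ)]
  exact one_div_sq_mul_pow_four (by positivity) (by positivity) (by ring)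

theorem hasSum_evenOverOdd_add_oddOverOdd {a b : ℕ} (ha : 2 ≤ a) (hab : 4 ≤ a + b) :
    HasSum (fun x : ℕ × ℕ => 1 / ((2 * (x.1 : ℝ) + 2 + x.2) ^ a * (2 * x.1 + 1) ^ b))
      (evenOverOdd a b + oddOverOdd a b) := by
  refine .of_column_even_odd ((hasSum_evenOverOdd ha hab).congr_fun fun x => ?_)
    ((hasSum_oddOverOdd ha hab).congr_fun fun x => ?_) <;>
  · push_cast
    ring_nf

theorem hasSum_sum_mul_smaller {a b : ℕ} (ha : 2 ≤ a) (hab : 4 ≤ a + b) :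
    HasSum (fun x : ℕ × ℕ => 1 / ((2 * (2 * (x.1 : ℝ) + 2 + x.2)) ^ a * (2 * x.1 + 1) ^ b))
      (1 / 2 ^ a * (evenOverOdd a b + oddOverOdd a b)) := by
  refine ((hasSum_evenOverOdd_add_oddOverOdd ha hab).mul_left (1 / 2 ^ a)).congr_fun fun x => ?_
  rw [one_div_mul_one_div, mul_pow, mul_assoc]

theorem hasSum_sum_mul_larger {a b : ℕ} (ha : 2 ≤ a) (hab : 4 ≤ a + b) :
    HasSum (fun x : ℕ × ℕ => 1 / ((2 * (2 * (x.1 : ℝ) + 2 + x.2)) ^ a *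
      (2 * ((x.1 : ℝ) + x.2) + 3) ^ b))
      (evenOverOdd a b - 1 / 2 ^ a * (oddZeta (a + b) + (evenOverOdd a b + oddOverOdd a b))) := by
  have he := hasSum_evenOverOdd ha hab
  have hv : (fun x : ℕ × ℕ => (x.1 + 1 + x.2, x.1)).Injective := by
    rintro ⟨i, j⟩ ⟨k, l⟩ h
    simp only [Prod.mk.injEq] at h ⊢
    lia
  have hB := (he.summable.comp_injective hv).hasSum
  have hA := HasSum.of_column_zero_succ
    (G := fun x : ℕ × ℕ => 1 / ((2 * ((x.1 : ℝ) + ((x.1 + x.2 : ℕ) : ℝ)) + 2) ^ a *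
      (2 * x.1 + 1) ^ b))
    (((hasSum_oddZeta (s := a + b) (by lia)).mul_left (1 / 2 ^ a)).congr_fun fun n => by
      rw [one_div_mul_one_div, pow_add, ← mul_assoc, ← mul_pow, add_zero]
      ring_nf)
    ((hasSum_sum_mul_smaller ha hab).congr_fun fun x => by push_cast; ring_nf)
  have := he.unique (hA.of_triangles hB)
  rw [← mul_add] at this
  rw [← eq_sub_iff_add_eq'.2 this.symm]
  refine hB.congr_fun fun x => ?_
  simp only [Function.comp_apply]
  push_cast
  ring_nf

theorem oddOverOdd_four_two :
    oddOverOdd 4 2 =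
      4 * (1 / 2 ^ 5 * (evenOverOdd 5 1 + oddOverOdd 5 1)) +
      1 / 2 ^ 4 * (evenOverOdd 4 2 + oddOverOdd 4 2) +
      ((evenOverOdd 2 4 - 1 / 2 ^ 2 * (oddZeta 6 + (evenOverOdd 2 4 + oddOverOdd 2 4))) +
      2 * (evenOverOdd 3 3 - 1 / 2 ^ 3 * (oddZeta 6 + (evenOverOdd 3 3 + oddOverOdd 3 3))) +
      3 * (evenOverOdd 4 2 - 1 / 2 ^ 4 * (oddZeta 6 + (evenOverOdd 4 2 + oddOverOdd 4 2))) +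
      4 * (evenOverOdd 5 1 - 1 / 2 ^ 5 * (oddZeta 6 + (evenOverOdd 5 1 + oddOverOdd 5 1)))) := by
  have p42 := hasSum_sum_mul_smaller (a := 4) (b := 2) (by norm_num) (by norm_num)
  have p51 := hasSum_sum_mul_smaller (a := 5) (b := 1) (by norm_num) (by norm_num)
  have q24 := hasSum_sum_mul_larger (a := 2) (b := 4) (by norm_num) (by norm_num)
  have q33 := hasSum_sum_mul_larger (a := 3) (b := 3) (by norm_num) (by norm_num)
  have q42 := hasSum_sum_mul_larger (a := 4) (b := 2) (by norm_num) (by norm_num)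
  have q51 := hasSum_sum_mul_larger (a := 5) (b := 1) (by norm_num) (by norm_num)
  refine (hasSum_oddOverOdd (a := 4) (b := 2) (by norm_num) (by norm_num)).unique
    ((((p51.mul_left 4).add p42).add (((q24.add (q33.mul_left 2)).add
      (q42.mul_left 3)).add (q51.mul_left 4))).congr_fun fun x => ?_)
  rw [mul_comm, ← one_div_mul_one_div]
  exact one_div_sq_mul_pow_four (by positivity) (by positivity) (by ring)

theorem HasSum.congr_val {α : Type*} {f : α → ℝ} {a b : ℝ} (hf : HasSum f a) (h : a = b) :
    HasSum f b :=
  h ▸ hf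

theorem hasSum_oddOverOdd_rows {a b : ℕ} (ha : 2 ≤ a) (hab : 4 ≤ a + b) :
    HasSum (fun n : ℕ => 1 / (2 * (n : ℝ) + 1) ^ a * ∑ m ∈ range n, 1 / (2 * (m : ℝ) + 1) ^ b)
      (oddOverOdd a b) := by
  rw [← hasSum_nat_add_iff' 1]
  simp only [sum_range_one, range_zero, sum_empty, mul_zero, sub_zero]
  refine (hasSum_oddOverOdd ha hab).antidiagonal.congr_fun fun n => ?_
  rw [mul_sum]
  refine sum_congr rfl fun m hm => ?_
  have : m ≤ n := by simpa [Nat.lt_succ_iff] using hm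
  rw [one_div_mul_one_div]
  push_cast [Nat.cast_sub this]
  ring_nf

theorem hasSum_oddOverEven_rows {a b : ℕ} (ha : 2 ≤ a) (hab : 4 ≤ a + b) :
    HasSum (fun n : ℕ => 1 / (2 * (n : ℝ) + 1) ^ a * ∑ m ∈ range n, 1 / (2 * (m : ℝ) + 2) ^ b)
      (oddOverEven a b) := by
  rw [← hasSum_nat_add_iff' 1]
  simp only [sum_range_one, range_zero, sum_empty, mul_zero, sub_zero]
  refine (hasSum_oddOverEven ha hab).antidiagonal.congr_fun fun n => ?_
  rw [mul_sum]
  refine sum_congr rfl fun m hm => ?_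
  have : m ≤ n := by simpa [Nat.lt_succ_iff] using hm
  rw [one_div_mul_one_div]
  push_cast [Nat.cast_sub this]
  ring_nf

theorem tendsto_one_div_two_mul_add (c : ℝ) :
    Tendsto (fun k : ℕ => 1 / (2 * (k : ℝ) + c)) atTop (𝓝 0) := by
  simp only [one_div]
  exact ((tendsto_natCast_atTop_atTop.const_mul_atTop two_pos).atTop_add
    tendsto_const_nhds).inv_tendsto_atTop

theorem hasSum_one_div_even_mul_odd (n : ℕ) :
    HasSum (fun j : ℕ => 1 / ((2 * ((n : ℝ) + j) + 2) * (2 * ((n : ℝ) + j) + 3)))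
      (1 / (2 * (n : ℝ) + 1) - pairedLogTwo + ∑ m ∈ range n, 1 / (2 * (m : ℝ) + 1) -
        ∑ m ∈ range n, 1 / (2 * (m : ℝ) + 2)) := by
  induction n with
  | zero =>
    have ht : HasSum (fun j : ℕ => 2 / ((2 * (j : ℝ) + 1) * (2 * j + 3)))
        (-(-1 / (2 * ((0 : ℕ) : ℝ) + 1))) := by
      refine hasSum_of_telescope (T := fun k : ℕ => -1 / (2 * (k : ℝ) + 1)) (fun k => ?_) ?_ ?_
      · push_cast
        field_simp
        ring
      · refine ((summable_one_div_succ_pow (p := 2) (by norm_num)).mul_left 2).of_nonneg_of_le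
          (fun k => by positivity) fun k => ?_
        rw [mul_one_div]
        gcongr
        nlinarith [(k.cast_nonneg : (0 : ℝ) ≤ k)]
      · simpa only [neg_div, neg_zero] using (tendsto_one_div_two_mul_add 1).neg
    simp only [range_zero, sum_empty, add_zero, sub_zero]
    rw [← neg_neg (1 / (2 * ((0 : ℕ) : ℝ) + 1)), ← neg_div]
    refine (ht.sub hasSum_pairedLogTwo).congr_fun fun j => ?_
    push_cast
    field_simp
    ring
  | succ n ih =>
    have hv : 1 / (2 * ((n + 1 : ℕ) : ℝ) + 1) + 1 / (2 * (n : ℝ) + 1) - 1 / (2 * (n : ℝ) + 2) =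
        1 / (2 * (n : ℝ) + 1) - 1 / ((2 * (n : ℝ) + 2) * (2 * n + 3)) := by
      push_cast
      field_simp
      ring
    have hs := (hasSum_nat_add_iff' 1).2 ih
    simp only [sum_range_one, Nat.cast_zero, add_zero] at hs
    rw [sum_range_succ, sum_range_succ]
    refine HasSum.congr_fun (hs.congr_val ?_) fun j => ?_
    · linear_combination -hv
    · push_cast
      ring_nf

theorem hasSum_one_div_odd_sub (n : ℕ) :
    HasSum (fun i : ℕ => 1 / (2 * (i : ℝ) + 1) - 1 / (2 * ((n : ℝ) + i) + 2))
      (pairedLogTwo + ∑ m ∈ range n, 1 / (2 * (m : ℝ) + 2)) := by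
  induction n with
  | zero =>
    simp only [range_zero, sum_empty, add_zero]
    refine hasSum_pairedLogTwo.congr_fun fun i => ?_
    push_cast
    field_simp
    ring
  | succ n ih =>
    have ht : HasSum (fun i : ℕ => 1 / (2 * ((n : ℝ) + i) + 2) - 1 / (2 * ((n : ℝ) + i) + 4))
        (-(-1 / (2 * ((0 : ℕ) : ℝ) + (2 * n + 2)))) := by
      refine hasSum_of_telescope (T := fun k : ℕ => -1 / (2 * (k : ℝ) + (2 * n + 2)))
        (fun k => ?_) ?_ ?_
      · push_cast
        field_simp
        ring
      · refine ((summable_one_div_succ_pow (p := 2) (by norm_num)).mul_left 2).of_nonneg_of_le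
          (fun k => ?_) fun k => ?_
        · rw [sub_nonneg]
          gcongr
          norm_num
        · rw [mul_one_div, div_sub_div _ _ (by positivity) (by positivity)]
          gcongr
          · linarith
          · nlinarith [(k.cast_nonneg : (0 : ℝ) ≤ k), (n.cast_nonneg : (0 : ℝ) ≤ n),
              mul_nonneg (k.cast_nonneg : (0 : ℝ) ≤ k) (n.cast_nonneg : (0 : ℝ) ≤ n)]
      · simpa only [neg_div, neg_zero] using (tendsto_one_div_two_mul_add (2 * (n : ℝ) + 2)).neg
    rw [sum_range_succ, ← add_assoc]
    refine HasSum.congr_fun ((ih.add ht).congr_val ?_) fun i => ?_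
    · simp [neg_div]
    · push_cast
      ring_nf

theorem tailKernelSum_eq :
    tailKernelSum = oddZeta 6 - pairedLogTwo * oddZeta 5 + oddOverOdd 5 1 - oddOverEven 5 1 := by
  have h6 := hasSum_oddZeta (s := 6) (by norm_num)
  have h5 := hasSum_oddZeta (s := 5) (by norm_num)
  have o := hasSum_oddOverOdd_rows (a := 5) (b := 1) (by norm_num) (by norm_num)
  have d := hasSum_oddOverEven_rows (a := 5) (b := 1) (by norm_num) (by norm_num)
  have hr (n : ℕ) := (hasSum_one_div_even_mul_odd n).mul_left (1 / (2 * (n : ℝ) + 1) ^ 5)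
  refine (hasSum_tailKernel.prod_fiberwise hr).unique
    ((((h6.sub (h5.mul_left pairedLogTwo)).add o).sub d).congr_fun fun n => ?_)
  simp only [pow_one]
  field_simp

theorem evenOverOdd_weight_six :
    2 * evenOverOdd 5 1 + evenOverOdd 4 2 + evenOverOdd 3 3 + evenOverOdd 2 4 =
      pairedLogTwo * oddZeta 5 + oddOverEven 5 1 := by
  have e24 := hasSum_evenOverOdd (a := 2) (b := 4) (by norm_num) (by norm_num)
  have e33 := hasSum_evenOverOdd (a := 3) (b := 3) (by norm_num) (by norm_num)
  have e42 := hasSum_evenOverOdd (a := 4) (b := 2) (by norm_num) (by norm_num)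
  have e51 := hasSum_evenOverOdd (a := 5) (b := 1) (by norm_num) (by norm_num)
  have h5 := hasSum_oddZeta (s := 5) (by norm_num)
  have d := hasSum_oddOverEven_rows (a := 5) (b := 1) (by norm_num) (by norm_num)
  have hs := ((((e51.swap.add e51).add e42).add e33).add e24).congr_fun
    (g := fun x : ℕ × ℕ => 1 / (2 * (x.1 : ℝ) + 1) ^ 5 *
      (1 / (2 * (x.2 : ℝ) + 1) - 1 / (2 * ((x.1 : ℝ) + x.2) + 2))) fun x => by
    rw [add_comm (x.2 : ℝ)]
    exact one_div_pow_five_mul_sub (by positivity) (by positivity) (by ring)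
  rw [two_mul]
  have hr (n : ℕ) := (hasSum_one_div_odd_sub n).mul_left (1 / (2 * (n : ℝ) + 1) ^ 5)
  refine (hs.prod_fiberwise hr).unique
    (((h5.mul_left pairedLogTwo).add d).congr_fun fun n => ?_)
  simp only [pow_one]
  ring

theorem hasSum_zeta {s : ℕ} (hs : 2 ≤ s) : HasSum (fun n : ℕ => 1 / ((n : ℝ) + 1) ^ s) (zeta s) :=
  (summable_one_div_succ_pow hs).hasSum

theorem evenZeta_eq {s : ℕ} (hs : 2 ≤ s) : evenZeta s = 1 / 2 ^ s * zeta s := by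
  refine (hasSum_evenZeta hs).unique (((hasSum_zeta hs).mul_left (1 / 2 ^ s)).congr_fun fun n => ?_)
  rw [one_div_mul_one_div, ← mul_pow]
  ring_nf

theorem oddZeta_eq {s : ℕ} (hs : 2 ≤ s) : oddZeta s = (1 - 1 / 2 ^ s) * zeta s := by
  have h := HasSum.even_add_odd (f := fun n : ℕ => 1 / ((n : ℝ) + 1) ^ s)
    ((hasSum_oddZeta hs).congr_fun fun n => by push_cast; rfl)
    ((hasSum_evenZeta hs).congr_fun fun n => by push_cast; ring_nf)
  have := h.unique (hasSum_zeta hs)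
  rw [evenZeta_eq hs] at this
  linarith

theorem zeta_eq_of_hasSum {s : ℕ} {a : ℝ} (hs : s ≠ 0)
    (ha : HasSum (fun n : ℕ => 1 / (n : ℝ) ^ s) a) : zeta s = a := by
  rw [← hasSum_nat_add_iff' 1] at ha
  simpa [zeta, hs] using ha.tsum_eq

theorem bernoulli'_six : bernoulli' 6 = 1 / 42 := by
  have h5 : bernoulli' 5 = 0 := bernoulli'_eq_zero_of_odd (by decide) (by norm_num)
  rw [bernoulli'_def]
  norm_num [sum_range_succ, bernoulli'_zero, bernoulli'_one, bernoulli'_two, bernoulli'_three,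
    bernoulli'_four, h5, Nat.choose]

theorem zeta_two_mul_zeta_four : zeta 2 * zeta 4 = 7 / 4 * zeta 6 := by
  have h6 : HasSum (fun n : ℕ => 1 / (n : ℝ) ^ 6) (π ^ 6 / 945) := by
    refine (hasSum_zeta_nat three_ne_zero).congr_val ?_
    norm_num [bernoulli_eq_bernoulli'_of_ne_one, bernoulli'_six, Nat.factorial]
    ring
  rw [zeta_eq_of_hasSum (by norm_num) hasSum_zeta_two,
    zeta_eq_of_hasSum (by norm_num) hasSum_zeta_four,
    zeta_eq_of_hasSum (by norm_num) h6]
  ring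

theorem stmt11 :
    HasSum (fun k : ℕ => (h (k + 1)) ^ 3 / ((k : ℝ) + 1) ^ 3)
      ((135 / 128) * zeta 6 + (7 / 16) * (zeta 3) ^ 2) := by
  refine summable_h_pow_three.hasSum.congr_val ?_
  have hX := tailKernelSum_eq
  have hS := tsum_h_cube_eq
  have st42 := oddZeta_mul_oddZeta (a := 2) (b := 4) (by norm_num) (by norm_num)
  have st33 := oddZeta_mul_oddZeta (a := 3) (b := 3) (by norm_num) (by norm_num)
  have st24 := oddZeta_mul_evenZeta (a := 2) (b := 4) (by norm_num) (by norm_num)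
  have st42' := oddZeta_mul_evenZeta (a := 4) (b := 2) (by norm_num) (by norm_num)
  have r1 := oddZeta_three_mul_evenZeta_three
  have r2 := oddZeta_three_mul_oddZeta_three
  have r3 := oddZeta_two_mul_oddZeta_four
  have r4 := oddZeta_two_mul_evenZeta_four
  have r6 := evenOverOdd_weight_six
  have d42 := oddOverOdd_four_two
  have hz := zeta_two_mul_zeta_four
  have l2 := oddZeta_eq (s := 2) (by norm_num)
  have l3 := oddZeta_eq (s := 3) (by norm_num)
  have l4 := oddZeta_eq (s := 4) (by norm_num)
  have l6 := oddZeta_eq (s := 6) (by norm_num)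
  have m2 := evenZeta_eq (s := 2) (by norm_num)
  have m3 := evenZeta_eq (s := 3) (by norm_num)
  have m4 := evenZeta_eq (s := 4) (by norm_num)
  norm_num only [l2, l3, l4, l6, m2, m3, m4] at *
  ring_nf at *
  linarith
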